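/- arXiv:0905.4495 — 6 statements merged into one kernel-verified Lean document; each statement's English description precedes it below -/
import Mathlib

section
/- For every positive integer n, the identity (Σ_x q^{wt(x)}) · ∏_{j=1}^{n} ∏_{i=1}^{j} (1 − q^i) = ∏_{j=1}^{n} ∏_{i=1}^{j} (1 − q^{n−j+i}) holds in ℤ[q], where the sum ranges over all staircase arrays x of order n whose columns are strictly increasing, i.e. x_{i,j} < x_{i+1,j} whenever both entries exist; equivalently Σ_x q^{wt(x)} = ∏_{j=1}^{n} [n choose j]_q is the product of Gaussian binomial coefficients. In particular, setting q = 1, the number of such arrays equals ∏_{j=1}^{n} C(n,j). -/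
/-- A staircase array of order `n`: integers `x i j` for `1 ≤ i ≤ n`, `0 ≤ j ≤ n - i`
with `i ≤ x i j ≤ i + j`, encoded as a function `ℕ → ℕ → ℕ` pinned to `0` outside
the valid index range. -/
def IsStaircase (n : ℕ) (x : ℕ → ℕ → ℕ) : Prop :=
  (∀ i j, ¬(1 ≤ i ∧ i + j ≤ n) → x i j = 0) ∧
  (∀ i j, 1 ≤ i → i + j ≤ n → i ≤ x i j ∧ x i j ≤ i + j)

/-- The weight of a staircase array: `Σ_{i,j} (x i j - i)`. -/
def wt (n : ℕ) (x : ℕ → ℕ → ℕ) : ℕ :=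
  ∑ i ∈ Finset.Icc 1 n, ∑ j ∈ Finset.range (n + 1 - i), (x i j - i)

/-- Rows weakly increasing: `x i j ≤ x i (j+1)` whenever both entries exist. -/
def RowsWeak (n : ℕ) (x : ℕ → ℕ → ℕ) : Prop :=
  ∀ i j, 1 ≤ i → i + (j + 1) ≤ n → x i j ≤ x i (j + 1)

/-- Columns strictly increasing: `x i j < x (i+1) j` whenever both entries exist. -/
def ColsStrict (n : ℕ) (x : ℕ → ℕ → ℕ) : Prop :=
  ∀ i j, 1 ≤ i → (i + 1) + j ≤ n → x i j < x (i + 1) j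

/-- The condition `x i j ≤ x (i+1) (j-1)` whenever both entries exist. -/
def DiagBlue (n : ℕ) (x : ℕ → ℕ → ℕ) : Prop :=
  ∀ i j, 1 ≤ i → 1 ≤ j → i + j ≤ n → x i j ≤ x (i + 1) (j - 1)

/-- The condition `x i j ≤ x (i-1) (j+1) + 1` whenever both entries exist. -/
def DiagRed (n : ℕ) (x : ℕ → ℕ → ℕ) : Prop :=
  ∀ i j, 2 ≤ i → i + j ≤ n → x i j ≤ x (i - 1) (j + 1) + 1

open Classical in
/-- The strictly increasing columns `c 1 < ⋯ < c m` with `i ≤ c i ≤ i + j`, extended by zero. -/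
noncomputable def columns : ℕ → ℕ → Finset (ℕ → ℕ)
  | 0, _ => {0}
  | m + 1, j => (Finset.range (j + 1)).biUnion fun k =>
      (columns m k).image fun c => Function.update c (m + 1) (m + 1 + k)

theorem mem_columns {m j : ℕ} {c : ℕ → ℕ} :
    c ∈ columns m j ↔ (∀ i, ¬(1 ≤ i ∧ i ≤ m) → c i = 0) ∧
      (∀ i, 1 ≤ i → i ≤ m → i ≤ c i ∧ c i ≤ i + j) ∧
      (∀ i, 1 ≤ i → i + 1 ≤ m → c i < c (i + 1)) := by
  induction m generalizing j c with
  | zero =>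
    simp only [columns, Finset.mem_singleton, funext_iff, Pi.zero_apply]
    refine ⟨fun h => ⟨fun i _ => h i, fun i _ _ => by omega, fun i _ _ => by omega⟩,
      fun h i => h.1 i (by omega)⟩
  | succ m ih =>
    simp only [columns, Finset.mem_biUnion, Finset.mem_range, Finset.mem_image]
    constructor
    · rintro ⟨k, hk, d, hd, rfl⟩
      obtain ⟨h0, h1, h2⟩ := ih.1 hd
      refine ⟨fun i hi => ?_, fun i hi hi' => ?_, fun i hi hi' => ?_⟩
      · rw [Function.update_of_ne (by omega)]
        exact h0 i (by omega)
      · rcases eq_or_ne i (m + 1) with rfl | hne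
        · simp only [Function.update_self]
          omega
        · rw [Function.update_of_ne hne]
          have := h1 i hi (by omega)
          omega
      · rw [Function.update_of_ne (by omega)]
        rcases eq_or_ne i m with rfl | hne
        · simp only [Function.update_self]
          have := h1 i hi le_rfl
          omega
        · rw [Function.update_of_ne (by omega)]
          exact h2 i hi (by omega)
    · rintro ⟨h0, h1, h2⟩
      have hlast := h1 (m + 1) (by omega) le_rfl
      have hgap : ∀ d i, 1 ≤ i → i + d = m + 1 → c i + d ≤ c (m + 1) := by
        intro d
        induction d with
        | zero => rintro i - rfl; rfl
        | succ d ihd =>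
          intro i hi hid
          have := ihd (i + 1) (by omega) (by omega)
          have := h2 i hi (by omega)
          omega
      refine ⟨c (m + 1) - (m + 1), by omega, Function.update c (m + 1) 0,
        ih.2 ⟨fun i hi => ?_, fun i hi hi' => ?_, fun i hi hi' => ?_⟩, ?_⟩
      · rcases eq_or_ne i (m + 1) with rfl | hne
        · simp
        · rw [Function.update_of_ne hne]
          exact h0 i (by omega)
      · rw [Function.update_of_ne (by omega)]
        have := h1 i hi (by omega)
        have := hgap (m + 1 - i) i hi (by omega)
        omega
      · rw [Function.update_of_ne (by omega), Function.update_of_ne (by omega)]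
        exact h2 i hi (by omega)
      · rw [Function.update_idem, Nat.add_sub_cancel' hlast.1, Function.update_eq_self]

theorem sum_columns_succ {M : Type*} [AddCommMonoid M] (m j : ℕ) (f : (ℕ → ℕ) → M) :
    ∑ c ∈ columns (m + 1) j, f c = ∑ k ∈ Finset.range (j + 1), ∑ c ∈ columns m k,
      f (Function.update c (m + 1) (m + 1 + k)) := by
  classical
  rw [columns, Finset.sum_biUnion]
  · refine Finset.sum_congr rfl fun k _ => ?_
    convert Finset.sum_image ?_
    intro c hc d hd hcd
    funext i
    rcases eq_or_ne i (m + 1) with rfl | hne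
    · rw [(mem_columns.1 hc).1 _ (by omega), (mem_columns.1 hd).1 _ (by omega)]
    · simpa [hne] using congrFun hcd i
  · intro k _ l _ hkl
    refine Finset.disjoint_left.2 fun c hc hd => hkl ?_
    simp only [Finset.mem_image] at hc hd
    obtain ⟨c, -, rfl⟩ := hc
    obtain ⟨d, -, hd⟩ := hd
    simpa using (congrFun hd (m + 1)).symm

theorem card_columns (m j : ℕ) : (columns m j).card = (m + j).choose m := by
  induction m generalizing j with
  | zero => simp [columns]
  | succ m ih =>
    rw [Finset.card_eq_sum_ones, sum_columns_succ]
    simp only [← Finset.card_eq_sum_ones, ih]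
    induction j with
    | zero => simp
    | succ j ihj =>
      rw [Finset.sum_range_succ, ihj, show m + 1 + (j + 1) = (m + 1 + j) + 1 by ring,
        Nat.choose_succ_succ, add_comm, show m + (j + 1) = m + 1 + j by ring]

/-- The weight generating function of `columns m j`. -/
noncomputable def columnGenfun (m j : ℕ) : Polynomial ℤ :=
  ∑ c ∈ columns m j, Polynomial.X ^ ∑ i ∈ Finset.Icc 1 m, (c i - i)

theorem columnGenfun_succ (m j : ℕ) :
    columnGenfun (m + 1) j =
      ∑ k ∈ Finset.range (j + 1), Polynomial.X ^ k * columnGenfun m k := by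
  simp only [columnGenfun, sum_columns_succ, Finset.mul_sum]
  refine Finset.sum_congr rfl fun k _ => Finset.sum_congr rfl fun c _ => ?_
  rw [Finset.sum_Icc_succ_top (by omega), Function.update_self, Nat.add_sub_cancel_left, pow_add,
    mul_comm]
  congr 2
  refine Finset.sum_congr rfl fun i hi => ?_
  rw [Finset.mem_Icc] at hi
  rw [Function.update_of_ne (by omega)]

theorem columnGenfun_mul_prod (m j : ℕ) :
    columnGenfun m j * ∏ i ∈ Finset.range m, (1 - (Polynomial.X : Polynomial ℤ) ^ (i + 1)) =
      ∏ i ∈ Finset.range m, (1 - (Polynomial.X : Polynomial ℤ) ^ (j + (i + 1))) := by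
  induction m generalizing j with
  | zero => simp [columnGenfun, columns]
  | succ m ih =>
    induction j with
    | zero =>
      have h := ih 0
      simp only [zero_add] at h
      simp only [columnGenfun_succ, zero_add, Finset.sum_range_one, pow_zero, one_mul,
        Finset.prod_range_succ, ← mul_assoc, h]
    | succ j ihj =>
      rw [columnGenfun_succ, Finset.sum_range_succ, ← columnGenfun_succ, add_mul, ihj,
        Finset.prod_range_succ', Finset.prod_range_succ, Finset.prod_range_succ]
      have h := ih (j + 1)
      simp only [show ∀ i, j + (i + 1 + 1) = j + 1 + (i + 1) by intro i; ring] at h ⊢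
      linear_combination (Polynomial.X ^ (j + 1) * (1 - Polynomial.X ^ (m + 1))) * h

theorem prod_Icc_one_eq_prod_range {M : Type*} [CommMonoid M] (f : ℕ → M) (m : ℕ) :
    ∏ i ∈ Finset.Icc 1 m, f i = ∏ i ∈ Finset.range m, f (i + 1) := by
  induction m with
  | zero => simp
  | succ m ih => rw [Finset.prod_Icc_succ_top (by omega), ih, Finset.prod_range_succ]

theorem prod_fin_sub_eq_prod_Icc {M : Type*} [CommMonoid M] (f : ℕ → ℕ → M) (n : ℕ) :
    ∏ j : Fin n, f (n - j) j = ∏ m ∈ Finset.Icc 1 n, f m (n - m) := by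
  rw [Fin.prod_univ_eq_prod_range (fun j => f (n - j) j) n,
    prod_Icc_one_eq_prod_range, ← Finset.prod_range_reflect]
  refine Finset.prod_congr rfl fun j hj => ?_
  rw [Finset.mem_range] at hj
  congr 1 <;> omega

/-- A column-strict staircase array is the same as a choice of its columns. -/
noncomputable def colsStrictEquiv (n : ℕ) :
    {x : ℕ → ℕ → ℕ // IsStaircase n x ∧ ColsStrict n x} ≃
      {y // y ∈ Fintype.piFinset fun j : Fin n => columns (n - j) j} where
  toFun x := ⟨fun j i => x.1 i j, by
    obtain ⟨x, ⟨h0, h1⟩, h2⟩ := x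
    refine Fintype.mem_piFinset.2 fun j => mem_columns.2
      ⟨fun i hi => h0 i j (by omega), fun i hi hi' => h1 i j hi (by omega),
        fun i hi hi' => h2 i j hi (by omega)⟩⟩
  invFun y := ⟨fun i j => if h : j < n then y.1 ⟨j, h⟩ i else 0, by
    obtain ⟨y, hy⟩ := y
    have hc := fun j => mem_columns.1 (Fintype.mem_piFinset.1 hy j)
    refine ⟨⟨fun i j hij => ?_, fun i j hi hij => ?_⟩, fun i j hi hij => ?_⟩
    · dsimp only
      split_ifs with h
      · exact (hc ⟨j, h⟩).1 i (by dsimp only; omega)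
      · rfl
    · have h : j < n := by omega
      simpa only [h, dite_true] using (hc ⟨j, h⟩).2.1 i hi (by dsimp only; omega)
    · have h : j < n := by omega
      simpa only [h, dite_true] using (hc ⟨j, h⟩).2.2 i hi (by dsimp only; omega)⟩
  left_inv x := by
    obtain ⟨x, ⟨h0, h1⟩, h2⟩ := x
    ext i j
    dsimp only
    split_ifs with h
    · rfl
    · exact (h0 i j (by omega)).symm
  right_inv y := by
    ext j i
    simp

theorem wt_eq_sum_columns (n : ℕ) (x : ℕ → ℕ → ℕ) :
    wt n x = ∑ j : Fin n, ∑ i ∈ Finset.Icc 1 (n - j), (x i j - i) := by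
  rw [Fin.sum_univ_eq_sum_range (fun j => ∑ i ∈ Finset.Icc 1 (n - j), (x i j - i)) n, wt]
  refine Finset.sum_comm' fun i j => ?_
  simp only [Finset.mem_Icc, Finset.mem_range]
  omega

theorem finsum_X_pow_wt (n : ℕ) :
    ∑ᶠ x : {x : ℕ → ℕ → ℕ // IsStaircase n x ∧ ColsStrict n x},
        (Polynomial.X : Polynomial ℤ) ^ wt n x.1 =
      ∏ m ∈ Finset.Icc 1 n, columnGenfun m (n - m) := by
  let F : (Fin n → ℕ → ℕ) → Polynomial ℤ := fun y =>
    ∏ j : Fin n, Polynomial.X ^ ∑ i ∈ Finset.Icc 1 (n - (j : ℕ)), (y j i - i)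
  rw [← prod_fin_sub_eq_prod_Icc]
  simp only [columnGenfun]
  rw [Finset.prod_univ_sum, ← Finset.sum_coe_sort _ F, ← finsum_eq_sum_of_fintype,
    ← finsum_comp_equiv (colsStrictEquiv n)]
  refine finsum_congr fun x => ?_
  rw [wt_eq_sum_columns, ← Finset.prod_pow_eq_pow_sum]
  rfl

/-- The weight generating function of staircase arrays of order `n` with strictly
increasing columns is the product of Gaussian binomial coefficients
`∏_{j=1}^{n} [n choose j]_q`, stated denominator-free:
`(Σ_x q^{wt x}) · ∏_{j=1}^{n} ∏_{i=1}^{j} (1 - q^i) = ∏_{j=1}^{n} ∏_{i=1}^{j} (1 - q^{n-j+i})`.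
In particular there are `∏_{j=1}^{n} C(n,j)` such arrays. -/
theorem staircase_colstrict_genfun (n : ℕ) (hn : 0 < n) :
    ((∑ᶠ x : {x : ℕ → ℕ → ℕ // IsStaircase n x ∧ ColsStrict n x},
        (Polynomial.X : Polynomial ℤ) ^ wt n x.1) *
      ∏ j ∈ Finset.Icc 1 n, ∏ i ∈ Finset.Icc 1 j, (1 - (Polynomial.X : Polynomial ℤ) ^ i)
      = ∏ j ∈ Finset.Icc 1 n, ∏ i ∈ Finset.Icc 1 j,
          (1 - (Polynomial.X : Polynomial ℤ) ^ (n - j + i))) ∧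
    (Nat.card {x : ℕ → ℕ → ℕ // IsStaircase n x ∧ ColsStrict n x}
      = ∏ j ∈ Finset.Icc 1 n, n.choose j) := by
  constructor
  · rw [finsum_X_pow_wt, ← Finset.prod_mul_distrib]
    refine Finset.prod_congr rfl fun m _ => ?_
    rw [prod_Icc_one_eq_prod_range, prod_Icc_one_eq_prod_range, columnGenfun_mul_prod]
  · rw [Nat.card_congr (colsStrictEquiv n), Nat.card_eq_fintype_card, Fintype.card_coe,
      Fintype.card_piFinset]
    simp only [card_columns]
    rw [prod_fin_sub_eq_prod_Icc fun m j => (m + j).choose m]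
    refine Finset.prod_congr rfl fun m hm => ?_
    rw [Nat.add_sub_cancel' (Finset.mem_Icc.1 hm).2]
end

section
/- For every positive integer n, the identity Σ_x q^{wt(x)} = ∏_{j=1}^{n} C_j(q) holds in ℤ[q], where the sum ranges over all staircase arrays x of order n satisfying x_{i,j} ≤ x_{i+1,j−1} whenever both entries exist, and C_j(q) is the Carlitz–Riordan q-Catalan number. -/
/-- Area sequences of length `s`: `e 0 = 0`, each step rises by at most one, and the sequence is
padded by zeros from index `s` on. -/
def areaSeqs (s : ℕ) : Set (ℕ → ℕ) :=
  {e | e 0 = 0 ∧ (∀ j, e (j + 1) ≤ e j + 1) ∧ ∀ j, s ≤ j → e j = 0}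

/-- Concatenate the first `m` terms of `p`, a zero, and the first `s - m` terms of `t` raised
by one. -/
def glueSeq (s m : ℕ) (p t : ℕ → ℕ) : ℕ → ℕ := fun j =>
  if j < m then p j else if m < j ∧ j ≤ s then t (j - (m + 1)) + 1 else 0

theorem le_self_of_mem_areaSeqs {s : ℕ} {e : ℕ → ℕ} (he : e ∈ areaSeqs s) (j : ℕ) : e j ≤ j := by
  induction j with
  | zero => exact he.1.le
  | succ j ih => have := he.2.1 j; omega

theorem glueSeq_mem {s m : ℕ} (hm : m ≤ s) {p t : ℕ → ℕ} (hp : p ∈ areaSeqs m)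
    (ht : t ∈ areaSeqs (s - m)) : glueSeq s m p t ∈ areaSeqs (s + 1) := by
  obtain ⟨hp0, hp1, -⟩ := hp
  obtain ⟨ht0, ht1, -⟩ := ht
  refine ⟨?_, fun j => ?_, fun j hj => ?_⟩
  · simp [glueSeq, hp0]
  · rcases lt_trichotomy j m with h | h | h
    · have := hp1 j
      simp only [glueSeq]
      split_ifs <;> omega
    · subst h
      simp [glueSeq, ht0]
      split_ifs <;> omega
    · have := ht1 (j - (m + 1))
      rw [show j - (m + 1) + 1 = j + 1 - (m + 1) by omega] at this
      simp only [glueSeq]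
      split_ifs <;> omega
  · simp only [glueSeq]
    split_ifs <;> omega

theorem exists_glueSeq {s : ℕ} {e : ℕ → ℕ} (he : e ∈ areaSeqs (s + 1)) :
    ∃ m ≤ s, ∃ p ∈ areaSeqs m, ∃ t ∈ areaSeqs (s - m), glueSeq s m p t = e := by
  obtain ⟨h0, h1, h2⟩ := he
  set m := Nat.findGreatest (fun j => e j = 0) s with hm
  have hms : m ≤ s := Nat.findGreatest_le s
  have hem : e m = 0 := Nat.findGreatest_spec (P := fun j => e j = 0) (Nat.zero_le s) h0
  have hpos : ∀ j, m < j → j ≤ s → e j ≠ 0 := fun j hj hjs =>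
    Nat.findGreatest_is_greatest (P := fun j => e j = 0) hj hjs
  clear_value m
  refine ⟨m, hms, fun j => if j < m then e j else 0, ⟨?_, fun j => ?_, fun j hj => ?_⟩,
    fun j => e (j + (m + 1)) - 1, ⟨?_, fun j => ?_, fun j hj => ?_⟩, ?_⟩
  · simp [h0]
  · have := h1 j
    simp only
    split_ifs <;> omega
  · simp only
    split_ifs <;> omega
  · have := h1 m
    simp only [Nat.zero_add]
    omega
  · have := h1 (j + (m + 1))
    simp only [show j + 1 + (m + 1) = j + (m + 1) + 1 by omega]
    omega
  · have := h2 (j + (m + 1)) (by omega)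
    simp only [this]
  · funext j
    simp only [glueSeq]
    split_ifs with h h'
    · rfl
    · have := hpos j h'.1 h'.2
      rw [show j - (m + 1) + (m + 1) = j by omega]
      omega
    · by_cases hj : j = m
      · rw [hj, hem]
      · exact (h2 j (by omega)).symm

theorem glueSeq_index_le {s m m' : ℕ} {p t p' t' : ℕ → ℕ} (hm' : m' ≤ s)
    (h : glueSeq s m p t = glueSeq s m' p' t') : m' ≤ m := by
  by_contra! hlt
  have := congrFun h m'
  simp only [glueSeq, lt_irrefl, false_and, if_false, if_neg hlt.not_gt,
    if_pos (And.intro hlt hm')] at this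
  omega

theorem glueSeq_inj {s m : ℕ} {p t p' t' : ℕ → ℕ}
    (hp : p ∈ areaSeqs m) (ht : t ∈ areaSeqs (s - m)) (hp' : p' ∈ areaSeqs m)
    (ht' : t' ∈ areaSeqs (s - m)) (h : glueSeq s m p t = glueSeq s m p' t') :
    p = p' ∧ t = t' := by
  constructor
  · funext j
    by_cases hj : j < m
    · simpa [glueSeq, hj] using congrFun h j
    · rw [hp.2.2 j (by omega), hp'.2.2 j (by omega)]
  · funext j
    by_cases hj : j < s - m
    · have := congrFun h (j + (m + 1))
      simpa [glueSeq, show ¬ j + (m + 1) < m by omega, show m < j + (m + 1) by omega,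
        show j + (m + 1) ≤ s by omega] using this
    · rw [ht.2.2 j (by omega), ht'.2.2 j (by omega)]

theorem sum_glueSeq {s m : ℕ} (hm : m ≤ s) (p t : ℕ → ℕ) :
    ∑ j ∈ Finset.range (s + 1), glueSeq s m p t j =
      (s - m) + ∑ j ∈ Finset.range m, p j + ∑ j ∈ Finset.range (s - m), t j := by
  obtain ⟨r, rfl⟩ := Nat.exists_eq_add_of_le hm
  rw [show m + r + 1 = m + 1 + r by omega, Finset.sum_range_add, Finset.sum_range_succ]
  have hp : ∑ j ∈ Finset.range m, glueSeq (m + r) m p t j = ∑ j ∈ Finset.range m, p j :=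
    Finset.sum_congr rfl fun j hj => by simp [glueSeq, Finset.mem_range.1 hj]
  have ht : ∑ j ∈ Finset.range r, glueSeq (m + r) m p t (m + 1 + j) =
      ∑ j ∈ Finset.range r, (t j + 1) :=
    Finset.sum_congr rfl fun j hj => by
      have := Finset.mem_range.1 hj
      simp [glueSeq, show ¬ m + 1 + j < m by omega, show m < m + 1 + j by omega,
        show m + 1 + j ≤ m + r by omega]
  rw [hp, ht, Finset.sum_add_distrib]
  simp [glueSeq]
  omega

theorem finite_areaSeqs (s : ℕ) : (areaSeqs s).Finite := by
  induction s using Nat.strong_induction_on with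
  | _ s ih =>
    cases s with
    | zero =>
      refine (Set.finite_singleton (fun _ => 0)).subset fun e he => ?_
      exact funext fun j => he.2.2 j (Nat.zero_le j)
    | succ s =>
      refine ((Set.finite_Iic s).biUnion fun m hm => (ih m (Nat.lt_succ_of_le hm)).image2
        (glueSeq s m) (ih (s - m) (by omega))).subset fun e he => ?_
      obtain ⟨m, hm, p, hp, t, ht, rfl⟩ := exists_glueSeq he
      exact Set.mem_biUnion (Set.mem_Iic.2 hm) (Set.mem_image2_of_mem hp ht)

/-- The area generating function of area sequences of length `s`. -/
noncomputable def areaGenfun (s : ℕ) : Polynomial ℤ :=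
  ∑ e ∈ (finite_areaSeqs s).toFinset, Polynomial.X ^ ∑ j ∈ Finset.range s, e j

theorem areaGenfun_zero : areaGenfun 0 = 1 := by
  have : (finite_areaSeqs 0).toFinset = {fun _ => 0} := by
    ext e
    rw [Set.Finite.mem_toFinset, Finset.mem_singleton]
    constructor
    · exact fun he => funext fun j => he.2.2 j (Nat.zero_le j)
    · rintro rfl
      simp [areaSeqs]
  simp [areaGenfun, this]

theorem areaGenfun_succ (s : ℕ) : areaGenfun (s + 1) =
    ∑ m ∈ Finset.range (s + 1), Polynomial.X ^ (s - m) * areaGenfun m * areaGenfun (s - m) := by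
  have hprod : ∀ m ∈ Finset.range (s + 1),
      (Polynomial.X : Polynomial ℤ) ^ (s - m) * areaGenfun m * areaGenfun (s - m) =
        ∑ pt ∈ (finite_areaSeqs m).toFinset ×ˢ (finite_areaSeqs (s - m)).toFinset,
          (Polynomial.X : Polynomial ℤ) ^ ∑ j ∈ Finset.range (s + 1),
            glueSeq s m pt.1 pt.2 j := by
    intro m hm
    rw [Finset.sum_product, mul_assoc, areaGenfun, areaGenfun, Finset.sum_mul_sum,
      Finset.mul_sum]
    refine Finset.sum_congr rfl fun p _ => ?_
    rw [Finset.mul_sum]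
    refine Finset.sum_congr rfl fun t _ => ?_
    rw [sum_glueSeq (Nat.lt_succ_iff.1 (Finset.mem_range.1 hm)), pow_add, pow_add, mul_assoc]
  rw [Finset.sum_congr rfl hprod, Finset.sum_sigma', areaGenfun]
  symm
  refine Finset.sum_nbij (fun a => glueSeq s a.1 a.2.1 a.2.2) ?_ ?_ ?_ fun _ _ => rfl
  · rintro ⟨m, p, t⟩ h
    simp only [Finset.mem_sigma, Finset.mem_range, Finset.mem_product,
      Set.Finite.mem_toFinset] at h ⊢
    exact glueSeq_mem (by omega) h.2.1 h.2.2
  · rintro ⟨m, p, t⟩ h ⟨m', p', t'⟩ h' heq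
    simp only [Finset.coe_sigma, Set.mem_sigma_iff, Finset.mem_coe, Finset.mem_range,
      Finset.mem_product, Set.Finite.mem_toFinset] at h h' heq
    obtain rfl : m = m' :=
      le_antisymm (glueSeq_index_le (by omega) heq.symm) (glueSeq_index_le (by omega) heq)
    obtain ⟨rfl, rfl⟩ := glueSeq_inj h.2.1 h.2.2 h'.2.1 h'.2.2 heq
    rfl
  · intro e he
    rw [Finset.mem_coe, Set.Finite.mem_toFinset] at he
    obtain ⟨m, hm, p, hp, t, ht, rfl⟩ := exists_glueSeq he
    refine ⟨⟨m, p, t⟩, ?_, rfl⟩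
    simp only [Finset.coe_sigma, Set.mem_sigma_iff, Finset.mem_coe, Finset.mem_range,
      Finset.mem_product, Set.Finite.mem_toFinset]
    exact ⟨by omega, hp, ht⟩

theorem eq_areaGenfun (C : ℕ → Polynomial ℤ) (hC0 : C 0 = 1)
    (hCrec : ∀ j, 1 ≤ j → C j = ∑ k ∈ Finset.Icc 1 j,
      (Polynomial.X : Polynomial ℤ) ^ (k - 1) * C (k - 1) * C (j - k)) (s : ℕ) :
    C s = areaGenfun s := by
  induction s using Nat.strong_induction_on with
  | _ s ih =>
    cases s with
    | zero => rw [hC0, areaGenfun_zero]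
    | succ s =>
      rw [hCrec _ (by omega), areaGenfun_succ]
      refine Finset.sum_nbij' (fun k => s + 1 - k) (fun m => s + 1 - m) ?_ ?_ ?_ ?_ ?_
      · intro k hk; simp only [Finset.mem_Icc, Finset.mem_range] at hk ⊢; omega
      · intro m hm; simp only [Finset.mem_Icc, Finset.mem_range] at hm ⊢; omega
      · intro k hk; simp only [Finset.mem_Icc] at hk; omega
      · intro m hm; simp only [Finset.mem_range] at hm; omega
      · intro k hk
        rw [Finset.mem_Icc] at hk
        rw [ih (k - 1) (by omega), ih (s + 1 - k) (by omega),
          show s - (s + 1 - k) = k - 1 by omega, mul_right_comm]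

/-- The excesses `x i j - i` along the antidiagonal `i + j = s`, indexed by `j`. -/
def diagExcess (x : ℕ → ℕ → ℕ) (s j : ℕ) : ℕ := x (s - j) j - (s - j)

theorem diagExcess_mem {n : ℕ} {x : ℕ → ℕ → ℕ} (hx : IsStaircase n x) (hb : DiagBlue n x)
    {s : ℕ} (hs : 1 ≤ s) (hsn : s ≤ n) : diagExcess x s ∈ areaSeqs s := by
  refine ⟨?_, fun j => ?_, fun j hj => ?_⟩
  · have := hx.2 s 0 hs (by omega)
    simp only [diagExcess, Nat.sub_zero]
    omega
  · simp only [diagExcess]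
    by_cases hj : j + 1 < s
    · have := hb (s - (j + 1)) (j + 1) (by omega) (by omega) (by omega)
      rw [show s - (j + 1) + 1 = s - j by omega, Nat.add_sub_cancel] at this
      omega
    · rw [hx.1 (s - (j + 1)) (j + 1) (by omega)]
      omega
  · simp only [diagExcess]
    rw [hx.1 (s - j) j (by omega), Nat.zero_sub]

theorem wt_eq_sum_diagExcess (n : ℕ) (x : ℕ → ℕ → ℕ) :
    wt n x = ∑ s : Fin n, ∑ j ∈ Finset.range (s + 1), diagExcess x (s + 1) j := by
  rw [Fin.sum_univ_eq_sum_range (fun s => ∑ j ∈ Finset.range (s + 1), diagExcess x (s + 1) j) n,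
    wt, Finset.sum_sigma', Finset.sum_sigma']
  refine Finset.sum_nbij' (fun a => ⟨a.1 + a.2 - 1, a.2⟩) (fun a => ⟨a.1 + 1 - a.2, a.2⟩)
    ?_ ?_ ?_ ?_ ?_
  · rintro ⟨i, j⟩ h
    simp only [Finset.mem_sigma, Finset.mem_Icc, Finset.mem_range] at h ⊢
    omega
  · rintro ⟨i, j⟩ h
    simp only [Finset.mem_sigma, Finset.mem_Icc, Finset.mem_range] at h ⊢
    omega
  · rintro ⟨i, j⟩ h
    simp only [Finset.mem_sigma, Finset.mem_Icc, Finset.mem_range] at h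
    simp only [Sigma.mk.injEq, heq_eq_eq, and_true]
    omega
  · rintro ⟨i, j⟩ h
    simp only [Finset.mem_sigma, Finset.mem_range] at h
    simp only [Sigma.mk.injEq, heq_eq_eq, and_true]
    omega
  · rintro ⟨i, j⟩ h
    simp only [Finset.mem_sigma, Finset.mem_Icc, Finset.mem_range] at h
    simp only [diagExcess]
    rw [show i + j - 1 + 1 - j = i by omega]

theorem eq_of_diagExcess_eq {n : ℕ} {x y : ℕ → ℕ → ℕ} (hx : IsStaircase n x)
    (hy : IsStaircase n y) (h : ∀ s < n, diagExcess x (s + 1) = diagExcess y (s + 1)) :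
    x = y := by
  funext i j
  by_cases hij : 1 ≤ i ∧ i + j ≤ n
  · have := congrFun (h (i + j - 1) (by omega)) j
    simp only [diagExcess, show i + j - 1 + 1 - j = i by omega] at this
    have := hx.2 i j hij.1 hij.2
    have := hy.2 i j hij.1 hij.2
    omega
  · rw [hx.1 i j hij, hy.1 i j hij]

theorem exists_diagExcess_eq {n : ℕ} (e : ℕ → ℕ → ℕ) (he : ∀ s < n, e s ∈ areaSeqs (s + 1)) :
    ∃ x, IsStaircase n x ∧ DiagBlue n x ∧ ∀ s < n, diagExcess x (s + 1) = e s := by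
  refine ⟨fun i j => if 1 ≤ i ∧ i + j ≤ n then i + e (i + j - 1) j else 0,
    ⟨fun i j h => if_neg h, fun i j hi hij => ?_⟩, fun i j hi hj hij => ?_, fun s hs => ?_⟩
  · have := le_self_of_mem_areaSeqs (he (i + j - 1) (by omega)) j
    simp only [hi, hij, and_self, if_true]
    omega
  · obtain ⟨j, rfl⟩ := Nat.exists_eq_add_of_le' hj
    have := (he (i + (j + 1) - 1) (by omega)).2.1 j
    simp only [Nat.add_sub_cancel]
    rw [if_pos ⟨hi, hij⟩, if_pos ⟨by omega, by omega⟩,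
      show i + 1 + j - 1 = i + (j + 1) - 1 by omega]
    omega
  · funext j
    simp only [diagExcess]
    split_ifs with h
    · rw [show s + 1 - j + j - 1 = s by omega, Nat.add_sub_cancel_left]
    · rw [(he s hs).2.2 j (by omega), Nat.zero_sub]

/-- The weight generating function of staircase arrays of order `n` satisfying
`x i j ≤ x (i+1) (j-1)` is the product `∏_{j=1}^{n} C_j(q)` of Carlitz–Riordan
`q`-Catalan numbers, where the latter are characterized by `C_0(q) = 1` and the
recurrence `C_j(q) = Σ_{k=1}^{j} q^{k-1} C_{k-1}(q) C_{j-k}(q)` for `j ≥ 1`. -/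
theorem staircase_blue_genfun (n : ℕ) (hn : 0 < n) (C : ℕ → Polynomial ℤ)
    (hC0 : C 0 = 1)
    (hCrec : ∀ j, 1 ≤ j → C j = ∑ k ∈ Finset.Icc 1 j,
      (Polynomial.X : Polynomial ℤ) ^ (k - 1) * C (k - 1) * C (j - k)) :
    (∑ᶠ x : {x : ℕ → ℕ → ℕ // IsStaircase n x ∧ DiagBlue n x},
        (Polynomial.X : Polynomial ℤ) ^ wt n x.1)
      = ∏ j ∈ Finset.Icc 1 n, C j := by
  have hprod : ∏ j ∈ Finset.Icc 1 n, C j = ∏ s : Fin n, areaGenfun (s + 1) := by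
    rw [Fin.prod_univ_eq_prod_range (fun s => areaGenfun (s + 1)) n, Finset.range_eq_Ico,
      Finset.prod_Ico_add' areaGenfun 0 n 1]
    exact Finset.prod_congr rfl fun j _ => eq_areaGenfun C hC0 hCrec j
  rw [hprod]
  simp only [areaGenfun]
  rw [Finset.prod_univ_sum, ← Finset.sum_coe_sort, ← finsum_eq_sum_of_fintype]
  refine finsum_eq_of_bijective (fun x => ⟨fun s => diagExcess x.1 (s + 1), ?_⟩) ⟨?_, ?_⟩ ?_
  · simp only [Fintype.mem_piFinset, Set.Finite.mem_toFinset]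
    exact fun s => diagExcess_mem x.2.1 x.2.2 (by omega) (by omega)
  · rintro ⟨x, hx⟩ ⟨y, hy⟩ h
    simp only [Subtype.mk.injEq] at h ⊢
    exact eq_of_diagExcess_eq hx.1 hy.1 fun s hs => congrFun h ⟨s, hs⟩
  · rintro ⟨e, he⟩
    simp only [Fintype.mem_piFinset, Set.Finite.mem_toFinset] at he
    obtain ⟨x, hx, hb, hxe⟩ := exists_diagExcess_eq (n := n)
      (fun s => if h : s < n then e ⟨s, h⟩ else 0)
      (fun s hs => by simpa only [hs, dif_pos] using he ⟨s, hs⟩)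
    refine ⟨⟨x, hx, hb⟩, Subtype.ext (funext fun s => ?_)⟩
    simpa using hxe s s.2
  · intro x
    simp only [wt_eq_sum_diagExcess, Finset.prod_pow_eq_pow_sum]
end

section
/- For every positive integer n, the number of staircase arrays x of order n whose rows are weakly increasing, i.e. x_{i,j} ≤ x_{i,j+1} whenever both entries exist, equals the product of Catalan numbers ∏_{j=1}^{n} C_j, where C_j = (1/(j+1))·C(2j,j). -/
/-- The weakly increasing sequences `f 0 ≤ ⋯ ≤ f (m - 1)` with `f j ≤ j` and all entries at most
`k`, extended by `0`. -/
def ballotSeqs (m k : ℕ) : Set (ℕ → ℕ) :=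
  {f | (∀ j, m ≤ j → f j = 0) ∧ (∀ j, f j ≤ j) ∧ (∀ j, f j ≤ k) ∧
    ∀ j, j + 1 < m → f j ≤ f (j + 1)}

theorem ballotSeqs_le_last {m k : ℕ} {f : ℕ → ℕ} (hf : f ∈ ballotSeqs (m + 1) k) (j : ℕ) :
    f j ≤ f m := by
  obtain ⟨h0, -, -, hmono⟩ := hf
  by_cases hj : j ≤ m
  · induction hj using Nat.decreasingInduction with
    | self => exact le_rfl
    | of_succ i hi ih => exact (hmono i (by omega)).trans ih
  · simp [h0 j (by omega)]

theorem ballotSeqs_zero_left (k : ℕ) : ballotSeqs 0 k = {0} := by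
  ext f
  simp only [ballotSeqs, Set.mem_ofPred_eq, Set.mem_singleton_iff, funext_iff, Pi.zero_apply]
  refine ⟨fun h j => h.1 j (Nat.zero_le j), fun h => ?_⟩
  simp [h]

theorem ballotSeqs_zero_right (m : ℕ) : ballotSeqs m 0 = {0} := by
  ext f
  simp only [ballotSeqs, Set.mem_ofPred_eq, Set.mem_singleton_iff, funext_iff, Pi.zero_apply]
  refine ⟨fun h j => Nat.le_zero.mp (h.2.2.1 j), fun h => ?_⟩
  simp [h]

theorem ballotSeqs_diag (m : ℕ) : ballotSeqs (m + 1) (m + 1) = ballotSeqs (m + 1) m := by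
  ext f
  refine ⟨fun h => ⟨h.1, h.2.1, fun j => ?_, h.2.2.2⟩,
    fun h => ⟨h.1, h.2.1, fun j => (h.2.2.1 j).trans (Nat.le_succ m), h.2.2.2⟩⟩
  exact (ballotSeqs_le_last h j).trans (h.2.1 m)

theorem ballotSeqs_succ_succ {m k : ℕ} (hk : k + 1 ≤ m) :
    ballotSeqs (m + 1) (k + 1) =
      ballotSeqs (m + 1) k ∪ (fun f => Function.update f m (k + 1)) '' ballotSeqs m (k + 1) := by
  ext f
  constructor
  · intro h
    by_cases hm : f m ≤ k
    · exact Or.inl ⟨h.1, h.2.1, fun j => (ballotSeqs_le_last h j).trans hm, h.2.2.2⟩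
    · have hfm : f m = k + 1 := le_antisymm (h.2.2.1 m) (by omega)
      refine Or.inr ⟨Function.update f m 0, ?_, by simp [← hfm]⟩
      obtain ⟨h0, hj, hb, hmono⟩ := h
      refine ⟨fun j hmj => ?_, fun j => ?_, fun j => ?_, fun j hjm => ?_⟩
      · rcases eq_or_ne j m with rfl | hne
        · simp
        · simpa [hne] using h0 j (by omega)
      · rcases eq_or_ne j m with rfl | hne
        · simp
        · simpa [hne] using hj j
      · rcases eq_or_ne j m with rfl | hne
        · simp
        · simpa [hne] using hb j
      · simpa [show j ≠ m by omega, show j + 1 ≠ m by omega] using hmono j (by omega)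
  · rintro (h | ⟨g, ⟨h0, hj, hb, hmono⟩, rfl⟩)
    · exact ⟨h.1, h.2.1, fun j => (h.2.2.1 j).trans (Nat.le_succ k), h.2.2.2⟩
    · refine ⟨fun j hmj => ?_, fun j => ?_, fun j => ?_, fun j hjm => ?_⟩
      · simpa [show j ≠ m by omega] using h0 j (by omega)
      · rcases eq_or_ne j m with rfl | hne
        · simpa using hk
        · simpa [hne] using hj j
      · rcases eq_or_ne j m with rfl | hne
        · simp
        · simpa [hne] using hb j
      · rcases eq_or_ne (j + 1) m with rfl | hne
        · simpa using hb j
        · simpa [show j ≠ m by omega, hne] using hmono j (by omega)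

theorem ballotSeqs_disjoint (m k : ℕ) :
    Disjoint (ballotSeqs (m + 1) k)
      ((fun f => Function.update f m (k + 1)) '' ballotSeqs m (k + 1)) := by
  rw [Set.disjoint_left]
  rintro _ h ⟨g, -, rfl⟩
  simpa using h.2.2.1 m

theorem injOn_update_ballotSeqs (m k : ℕ) :
    Set.InjOn (fun f : ℕ → ℕ => Function.update f m (k + 1)) (ballotSeqs m (k + 1)) := by
  intro f hf g hg hfg
  ext j
  rcases eq_or_ne j m with rfl | hne
  · rw [hf.1 j le_rfl, hg.1 j le_rfl]
  · simpa [hne] using congrFun hfg j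

/-- The ballot number formula, `#(ballotSeqs m k) = C(m + k, m) - C(m + k, m + 1)`. -/
theorem ballotSeqs_finite_and_ncard (m k : ℕ) (hk : k ≤ m) :
    (ballotSeqs m k).Finite ∧
      (ballotSeqs m k).ncard + (m + k).choose (m + 1) = (m + k).choose m := by
  induction m generalizing k with
  | zero =>
    obtain rfl : k = 0 := by omega
    simp [ballotSeqs_zero_left]
  | succ m ihm =>
    have below : ∀ k ≤ m, (ballotSeqs (m + 1) k).Finite ∧
        (ballotSeqs (m + 1) k).ncard + (m + 1 + k).choose (m + 1 + 1) =
          (m + 1 + k).choose (m + 1) := by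
      intro k hkm
      induction k with
      | zero => simp [ballotSeqs_zero_right]
      | succ k ihk =>
        obtain ⟨fin₁, card₁⟩ := ihk (by omega)
        obtain ⟨fin₂, card₂⟩ := ihm (k + 1) hkm
        have fin₃ := fin₂.image (fun f : ℕ → ℕ => Function.update f m (k + 1))
        rw [ballotSeqs_succ_succ hkm]
        refine ⟨fin₁.union fin₃, ?_⟩
        rw [Set.ncard_union_eq (ballotSeqs_disjoint m k) fin₁ fin₃,
          Set.InjOn.ncard_image (injOn_update_ballotSeqs m k),
          show m + 1 + (k + 1) = (m + 1 + k) + 1 by ring, Nat.choose_succ_succ (m + 1 + k) (m + 1),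
          Nat.choose_succ_succ (m + 1 + k) m]
        rw [show m + (k + 1) = m + 1 + k by ring] at card₂
        simp only [Nat.succ_eq_add_one] at *
        omega
    rcases hk.lt_or_eq with hlt | rfl
    · exact below k (by omega)
    · obtain ⟨fin, card⟩ := below m le_rfl
      rw [ballotSeqs_diag]
      refine ⟨fin, ?_⟩
      have hsymm : (m + 1 + m).choose (m + 1) = (m + 1 + m).choose m := by
        rw [show m + 1 + m = 2 * m + 1 by ring]
        exact Nat.choose_symm_half m
      rw [show m + 1 + (m + 1) = (m + 1 + m) + 1 by ring, Nat.choose_succ_succ (m + 1 + m) (m + 1),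
        Nat.choose_succ_succ (m + 1 + m) m]
      simp only [Nat.succ_eq_add_one] at *
      omega

theorem card_ballotSeqs_self (m : ℕ) :
    Nat.card (ballotSeqs m m) = (2 * m).choose m / (m + 1) := by
  have h := (ballotSeqs_finite_and_ncard m m le_rfl).2
  have h' := Nat.choose_succ_right_eq (2 * m) m
  rw [← two_mul] at h
  rw [show 2 * m - m = m by omega] at h'
  rw [Nat.card_coe_set_eq]
  refine (Nat.div_eq_of_eq_mul_left m.succ_pos ?_).symm
  rw [Nat.succ_eq_add_one]
  nlinarith

/-- A staircase array with weakly increasing rows is a family of independent rows; row `i + 1`,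
lowered by `i + 1`, is an arbitrary element of `ballotSeqs (n - i) (n - i)`. -/
def rowsEquiv (n : ℕ) :
    {x : ℕ → ℕ → ℕ // IsStaircase n x ∧ RowsWeak n x} ≃
      ((i : Fin n) → ballotSeqs (n - i) (n - i)) where
  toFun x i := ⟨fun j => x.1 (i + 1) j - (i + 1), by
    obtain ⟨x, ⟨h0, hx⟩, hr⟩ := x
    have hi := i.2
    have hz : ∀ j, n - i ≤ j → x (i + 1) j = 0 := fun j hj => h0 _ _ (by omega)
    refine ⟨fun j hj => by simp [hz j hj], fun j => ?_, fun j => ?_, fun j hj => ?_⟩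
    · by_cases hj : n - i ≤ j
      · simp [hz j hj]
      · have := hx (i + 1) j (by omega) (by omega)
        dsimp only
        omega
    · by_cases hj : n - i ≤ j
      · simp [hz j hj]
      · have := hx (i + 1) j (by omega) (by omega)
        dsimp only
        omega
    · exact Nat.sub_le_sub_right (hr (i + 1) j (by omega) (by omega)) _⟩
  invFun y := ⟨fun i j => if h : 1 ≤ i ∧ i + j ≤ n then (y ⟨i - 1, by omega⟩).1 j + i else 0, by
    refine ⟨⟨fun i j h => dif_neg h, fun i j hi hij => ?_⟩, fun i j hi hij => ?_⟩
    · have := (y ⟨i - 1, by omega⟩).2.2.1 j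
      simp only [hi, hij, and_self, dite_true]
      omega
    · have := (y ⟨i - 1, by omega⟩).2.2.2.2 j (by dsimp only; omega)
      simp only [hi, hij, show i + j ≤ n by omega, and_self, dite_true]
      omega⟩
  left_inv x := by
    obtain ⟨x, ⟨h0, hx⟩, hr⟩ := x
    ext i j
    dsimp only
    split_ifs with h
    · have := hx i j h.1 h.2
      rw [Nat.sub_add_cancel h.1]
      omega
    · exact (h0 i j h).symm
  right_inv y := by
    ext i j
    dsimp only
    split_ifs with h
    · simp
    · have hi := i.2
      rw [(y i).2.1 j (by omega), Nat.zero_sub]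

/-- The number of staircase arrays of order `n` with weakly increasing rows equals the
product of Catalan numbers `∏_{j=1}^{n} (1/(j+1))·C(2j,j)`. -/
theorem staircase_rowweak_count (n : ℕ) (hn : 0 < n) :
    Nat.card {x : ℕ → ℕ → ℕ // IsStaircase n x ∧ RowsWeak n x}
      = ∏ j ∈ Finset.Icc 1 n, (2 * j).choose j / (j + 1) := by
  rw [Nat.card_congr (rowsEquiv n), Nat.card_pi]
  simp only [card_ballotSeqs_self]
  rw [Fin.prod_univ_eq_prod_range (fun i => (2 * (n - i)).choose (n - i) / (n - i + 1)) n,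
    ← Finset.prod_range_reflect, ← Finset.Ico_add_one_right_eq_Icc, Finset.prod_Ico_eq_prod_range]
  refine Finset.prod_congr (by simp) fun i hi => ?_
  rw [Finset.mem_range] at hi
  rw [show n - (n - 1 - i) = 1 + i by omega]
end

section
/- For every positive integer n, the identity Σ_x q^{wt(x)} = ∏_{j=1}^{n−1} (1 + q^j)^{n−j} holds in ℤ[q], where the sum ranges over all staircase arrays x of order n satisfying both x_{i,j} ≤ x_{i+1,j−1} and x_{i,j} ≤ x_{i−1,j+1} + 1 whenever the relevant entries exist. -/
/-- The cells `(i, j)` of the staircase of order `n` with `1 ≤ i` and `1 ≤ j`. -/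
def stairCells (n : ℕ) : Finset (ℕ × ℕ) :=
  (Finset.Icc 1 n ×ˢ Finset.Icc 1 n).filter fun p => p.1 + p.2 ≤ n

/-- The number of cells of `S` weakly below `(i, j)` on its antidiagonal, that is, of cells
`(i + c, j - c)` in `S` with `c < j`. -/
def diagCount (S : Finset (ℕ × ℕ)) : ℕ → ℕ → ℕ
  | _, 0 => 0
  | i, j + 1 => diagCount S (i + 1) j + if (i, j + 1) ∈ S then 1 else 0

/-- The staircase array of order `n` whose excess `x i j - i` counts the cells of `S` weakly
below `(i, j)` on its antidiagonal. -/
def stairArray (n : ℕ) (S : Finset (ℕ × ℕ)) (i j : ℕ) : ℕ :=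
  if 1 ≤ i ∧ i + j ≤ n then i + diagCount S i j else 0

theorem mem_stairCells {n : ℕ} {p : ℕ × ℕ} :
    p ∈ stairCells n ↔ 1 ≤ p.1 ∧ 1 ≤ p.2 ∧ p.1 + p.2 ≤ n := by
  simp only [stairCells, Finset.mem_filter, Finset.mem_product, Finset.mem_Icc]
  omega

theorem diagCount_le (S : Finset (ℕ × ℕ)) (i j : ℕ) : diagCount S i j ≤ j := by
  induction j generalizing i with
  | zero => simp [diagCount]
  | succ j ih =>
    have := ih (i + 1)
    simp only [diagCount]
    split_ifs <;> omega

theorem diagCount_eq_sum (S : Finset (ℕ × ℕ)) (i j : ℕ) :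
    diagCount S i j = ∑ c ∈ Finset.range j, if (i + c, j - c) ∈ S then 1 else 0 := by
  induction j generalizing i with
  | zero => simp [diagCount]
  | succ j ih =>
    rw [diagCount, ih, Finset.sum_range_succ']
    simp [add_assoc, add_comm 1]

theorem stairArray_of_mem {n i j : ℕ} (S : Finset (ℕ × ℕ)) (hi : 1 ≤ i) (hij : i + j ≤ n) :
    stairArray n S i j = i + diagCount S i j :=
  if_pos ⟨hi, hij⟩

theorem stairArray_succ {n i j : ℕ} (S : Finset (ℕ × ℕ)) (hi : 1 ≤ i) (hij : i + (j + 1) ≤ n) :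
    stairArray n S i (j + 1) + 1
      = stairArray n S (i + 1) j + if (i, j + 1) ∈ S then 1 else 0 := by
  rw [stairArray_of_mem S hi hij, stairArray_of_mem S (by omega) (by omega), diagCount]
  omega

theorem isStaircase_stairArray (n : ℕ) (S : Finset (ℕ × ℕ)) :
    IsStaircase n (stairArray n S) := by
  refine ⟨fun i j h => if_neg h, fun i j hi hij => ?_⟩
  have := diagCount_le S i j
  rw [stairArray_of_mem S hi hij]
  omega

theorem diagBlue_stairArray (n : ℕ) (S : Finset (ℕ × ℕ)) : DiagBlue n (stairArray n S) := by
  rintro i (_ | j) hi hj hij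
  · omega
  · have := stairArray_succ S hi hij
    simp only [Nat.add_sub_cancel]
    split_ifs at this <;> omega

theorem diagRed_stairArray (n : ℕ) (S : Finset (ℕ × ℕ)) : DiagRed n (stairArray n S) := by
  rintro (_ | i) j hi hij
  · omega
  · have := stairArray_succ (i := i) (j := j) (n := n) S (by omega) (by omega)
    simp only [Nat.add_sub_cancel]
    omega

theorem wt_stairArray {n : ℕ} {S : Finset (ℕ × ℕ)} (hS : S ⊆ stairCells n) :
    wt n (stairArray n S) = ∑ p ∈ S, p.1 := by
  have hl : wt n (stairArray n S) = ∑ i ∈ Finset.Icc 1 n, ∑ j ∈ Finset.range (n + 1 - i),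
      ∑ c ∈ Finset.range j, if (i + c, j - c) ∈ S then 1 else 0 := by
    refine Finset.sum_congr rfl fun i hi => Finset.sum_congr rfl fun j hj => ?_
    simp only [Finset.mem_Icc, Finset.mem_range] at hi hj
    rw [stairArray_of_mem S hi.1 (by omega), diagCount_eq_sum, Nat.add_sub_cancel_left]
  have hr : ∑ p ∈ S, p.1 =
      ∑ p ∈ stairCells n, ∑ _i ∈ Finset.Icc 1 p.1, if p ∈ S then 1 else 0 := by
    simp [Finset.sum_ite_mem, Finset.inter_eq_right.mpr hS]
  rw [hl, hr]
  simp only [Finset.sum_sigma']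
  refine Finset.sum_nbij' (fun t => ⟨(t.1 + t.2.2, t.2.1 - t.2.2), t.1⟩)
    (fun t => ⟨t.2, t.1.2 + t.1.1 - t.2, t.1.1 - t.2⟩) ?_ ?_ ?_ ?_ ?_
  · rintro ⟨i, j, c⟩ h
    simp only [Finset.mem_sigma, Finset.mem_Icc, Finset.mem_range, mem_stairCells] at h ⊢
    omega
  · rintro ⟨⟨a, k⟩, i⟩ h
    simp only [Finset.mem_sigma, Finset.mem_Icc, Finset.mem_range, mem_stairCells] at h ⊢
    omega
  · rintro ⟨i, j, c⟩ h
    simp only [Finset.mem_sigma, Finset.mem_Icc, Finset.mem_range] at h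
    simp only [Sigma.mk.injEq, heq_eq_eq, true_and]
    omega
  · rintro ⟨⟨a, k⟩, i⟩ h
    simp only [Finset.mem_sigma, Finset.mem_Icc, mem_stairCells] at h
    simp only [Sigma.mk.injEq, heq_eq_eq, and_true, Prod.mk.injEq]
    omega
  · simp

theorem stairArray_injOn {n : ℕ} {S T : Finset (ℕ × ℕ)} (hS : S ⊆ stairCells n)
    (hT : T ⊆ stairCells n) (h : stairArray n S = stairArray n T) : S = T := by
  have key : ∀ p ∈ stairCells n, p ∈ S ↔ p ∈ T := by
    rintro ⟨i, j⟩ hp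
    obtain ⟨hi, hj, hij⟩ := mem_stairCells.mp hp
    obtain ⟨j, rfl⟩ := Nat.exists_eq_add_of_le' hj
    have h₁ := stairArray_succ S hi hij
    have h₂ := stairArray_succ T hi hij
    rw [h] at h₁
    split_ifs at h₁ h₂ <;> first | omega | tauto
  ext p
  exact ⟨fun hp => (key p (hS hp)).mp hp, fun hp => (key p (hT hp)).mpr hp⟩

theorem exists_stairArray_eq {n : ℕ} {x : ℕ → ℕ → ℕ} (hx : IsStaircase n x)
    (hb : DiagBlue n x) (hr : DiagRed n x) :
    ∃ S ⊆ stairCells n, stairArray n S = x := by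
  refine ⟨(stairCells n).filter fun p => x p.1 p.2 = x (p.1 + 1) (p.2 - 1),
    Finset.filter_subset _ _, ?_⟩
  set S := (stairCells n).filter fun p => x p.1 p.2 = x (p.1 + 1) (p.2 - 1) with hS
  have key : ∀ j i, 1 ≤ i → i + j ≤ n → stairArray n S i j = x i j := by
    intro j
    induction j with
    | zero =>
      intro i hi hij
      have := hx.2 i 0 hi hij
      rw [stairArray_of_mem S hi hij, diagCount]
      omega
    | succ j ih =>
      intro i hi hij
      have h₁ := stairArray_succ S hi hij
      have h₂ := ih (i + 1) (by omega) (by omega)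
      have h₃ := hb i (j + 1) hi (by omega) hij
      have h₄ := hr (i + 1) j (by omega) (by omega)
      have hmem : (i, j + 1) ∈ S ↔ x i (j + 1) = x (i + 1) j := by
        simp [hS, mem_stairCells, hi, hij]
      simp only [Nat.add_sub_cancel] at h₃ h₄
      simp only [hmem] at h₁
      split_ifs at h₁ <;> omega
  funext i j
  by_cases h : 1 ≤ i ∧ i + j ≤ n
  · exact key j i h.1 h.2
  · rw [hx.1 i j h, stairArray, if_neg h]

theorem prod_stairCells {M : Type*} [CommMonoid M] (n : ℕ) (f : ℕ → M) :
    ∏ p ∈ stairCells n, f p.1 = ∏ j ∈ Finset.Icc 1 (n - 1), f j ^ (n - j) := by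
  have h : ∀ j ∈ Finset.Icc 1 (n - 1), f j ^ (n - j) = ∏ _k ∈ Finset.Icc 1 (n - j), f j := by
    simp
  rw [Finset.prod_congr rfl h, Finset.prod_sigma']
  refine Finset.prod_nbij' (fun p => ⟨p.1, p.2⟩) (fun p => (p.1, p.2)) ?_ ?_ ?_ ?_ ?_
  · intro p hp
    simp only [Finset.mem_sigma, Finset.mem_Icc, mem_stairCells] at hp ⊢
    omega
  · intro p hp
    simp only [Finset.mem_sigma, Finset.mem_Icc, mem_stairCells] at hp ⊢
    omega
  all_goals simp

/-- The weight generating function of staircase arrays of order `n` satisfying both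
`x i j ≤ x (i+1) (j-1)` and `x i j ≤ x (i-1) (j+1) + 1` is
`∏_{j=1}^{n-1} (1 + q^j)^{n-j}`. -/
theorem staircase_blue_red_genfun (n : ℕ) (hn : 0 < n) :
    (∑ᶠ x : {x : ℕ → ℕ → ℕ // IsStaircase n x ∧ DiagBlue n x ∧ DiagRed n x},
        (Polynomial.X : Polynomial ℤ) ^ wt n x.1)
      = ∏ j ∈ Finset.Icc 1 (n - 1), (1 + (Polynomial.X : Polynomial ℤ) ^ j) ^ (n - j) := by
  let e : {S // S ∈ (stairCells n).powerset} →
      {x : ℕ → ℕ → ℕ // IsStaircase n x ∧ DiagBlue n x ∧ DiagRed n x} := fun S =>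
    ⟨stairArray n S, isStaircase_stairArray n S, diagBlue_stairArray n S, diagRed_stairArray n S⟩
  have he : Function.Bijective e := by
    refine ⟨fun S T h => Subtype.ext ?_, fun x => ?_⟩
    · exact stairArray_injOn (Finset.mem_powerset.mp S.2) (Finset.mem_powerset.mp T.2)
        (congrArg Subtype.val h)
    · obtain ⟨S, hS, h⟩ := exists_stairArray_eq x.2.1 x.2.2.1 x.2.2.2
      exact ⟨⟨S, Finset.mem_powerset.mpr hS⟩, Subtype.ext h⟩
  rw [← finsum_eq_of_bijective (f := fun S : {S // S ∈ (stairCells n).powerset} =>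
      (Polynomial.X : Polynomial ℤ) ^ ∑ p ∈ S.1, p.1) e he fun S => by
      rw [wt_stairArray (Finset.mem_powerset.mp S.2)],
    finsum_eq_sum_of_fintype, ← prod_stairCells n fun j => 1 + (Polynomial.X : Polynomial ℤ) ^ j,
    Finset.prod_one_add, Finset.sum_coe_sort (stairCells n).powerset
      fun S => (Polynomial.X : Polynomial ℤ) ^ ∑ p ∈ S, p.1]
  simp only [Finset.prod_pow_eq_pow_sum]
end

section
/- For every positive integer n, the set of staircase arrays x of order n satisfying x_{i,j} ≤ x_{i+1,j−1} and x_{i,j} ≤ x_{i−1,j+1} + 1 (whenever the relevant entries exist) is in bijection with the set of tournaments on n labeled vertices; in particular, the number of such arrays equals 2^{C(n,2)}. -/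
theorem Fin.card_pairs_lt (n : ℕ) :
    Nat.card {p : Fin n × Fin n // p.1 < p.2} = n.choose 2 := by
  have hrow (j : Fin n) : (∑ i : Fin n, if i < j then 1 else 0) = (j : ℕ) := by
    rw [← Finset.card_filter, ← Fin.card_Iio j]
    congr 1
    ext i
    simp
  rw [Nat.card_eq_fintype_card, Fintype.card_subtype, Finset.card_filter,
    Fintype.sum_prod_type_right]
  simp only [hrow]
  rw [Fin.sum_univ_eq_sum_range (fun j => j), Finset.sum_range_id, Nat.choose_two_right]

/-- The array whose antidiagonals descend from `i + j` by the steps recorded in `g`. -/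
def arrayOfSteps (g : ℕ → ℕ → Bool) : ℕ → ℕ → ℕ
  | i, 0 => i
  | i, j + 1 => arrayOfSteps g (i + 1) j - (g i (i + j + 1)).toNat

theorem arrayOfSteps_bounds (g : ℕ → ℕ → Bool) (i j : ℕ) :
    i ≤ arrayOfSteps g i j ∧ arrayOfSteps g i j ≤ i + j := by
  induction j generalizing i with
  | zero => simp [arrayOfSteps]
  | succ j ih =>
    have h := ih (i + 1)
    have hb := Bool.toNat_le (g i (i + j + 1))
    rw [arrayOfSteps]
    omega

/-- The restriction of `arrayOfSteps g` to the staircase of order `n`. -/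
def staircaseOfSteps (n : ℕ) (g : ℕ → ℕ → Bool) (i j : ℕ) : ℕ :=
  if 1 ≤ i ∧ i + j ≤ n then arrayOfSteps g i j else 0

theorem staircaseOfSteps_of_le {n i j : ℕ} (g : ℕ → ℕ → Bool) (hi : 1 ≤ i) (hij : i + j ≤ n) :
    staircaseOfSteps n g i j = arrayOfSteps g i j :=
  if_pos ⟨hi, hij⟩

theorem staircaseOfSteps_spec (n : ℕ) (g : ℕ → ℕ → Bool) :
    IsStaircase n (staircaseOfSteps n g) ∧ DiagBlue n (staircaseOfSteps n g) ∧
      DiagRed n (staircaseOfSteps n g) := by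
  refine ⟨⟨fun i j h => if_neg h, fun i j hi hij => ?_⟩, fun i j hi hj hij => ?_,
    fun i j hi hij => ?_⟩
  · rw [staircaseOfSteps_of_le g hi hij]
    exact arrayOfSteps_bounds g i j
  · obtain ⟨j, rfl⟩ := Nat.exists_eq_add_of_le' hj
    rw [staircaseOfSteps_of_le g hi hij, staircaseOfSteps_of_le g (by omega) (by omega),
      arrayOfSteps]
    exact Nat.sub_le _ _
  · obtain ⟨i, rfl⟩ := Nat.exists_eq_add_of_le' (show 1 ≤ i by omega)
    have hb := Bool.toNat_le (g i (i + j + 1))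
    rw [staircaseOfSteps_of_le g (by omega) hij, staircaseOfSteps_of_le g (by omega) (by omega),
      Nat.add_sub_cancel, arrayOfSteps]
    omega

/-- The tournament recording at which places the antidiagonals of an array strictly increase. -/
def tournamentOfArray (n : ℕ) (x : ℕ → ℕ → ℕ) (p : {p : Fin n × Fin n // p.1 < p.2}) : Bool :=
  decide (x (p.1.1 + 1) (p.1.2 - p.1.1) < x (p.1.1 + 2) (p.1.2 - p.1.1 - 1))

theorem eq_of_tournamentOfArray_eq {n : ℕ} {x y : ℕ → ℕ → ℕ}
    (hx : IsStaircase n x ∧ DiagBlue n x ∧ DiagRed n x)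
    (hy : IsStaircase n y ∧ DiagBlue n y ∧ DiagRed n y)
    (h : tournamentOfArray n x = tournamentOfArray n y) : x = y := by
  have key (j i : ℕ) (hi : 1 ≤ i) (hij : i + j ≤ n) : x i j = y i j := by
    induction j generalizing i with
    | zero =>
      have h1 := hx.1.2 i 0 hi hij
      have h2 := hy.1.2 i 0 hi hij
      omega
    | succ j ih =>
      obtain ⟨i, rfl⟩ := Nat.exists_eq_add_of_le' hi
      have hlt := congrFun h ⟨(⟨i, by omega⟩, ⟨i + j + 1, by omega⟩), by
        rw [Fin.lt_def]; dsimp only; omega⟩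
      have e : i + j + 1 - i = j + 1 := by omega
      simp only [tournamentOfArray, e, Nat.add_sub_cancel, decide_eq_decide] at hlt
      have hih := ih (i + 2) (by omega) (by omega)
      have dx := hx.2.1 (i + 1) (j + 1) hi (by omega) hij
      have rx := hx.2.2 (i + 2) j (by omega) (by omega)
      have dy := hy.2.1 (i + 1) (j + 1) hi (by omega) hij
      have ry := hy.2.2 (i + 2) j (by omega) (by omega)
      simp only [Nat.add_sub_cancel, add_assoc, Nat.reduceAdd,
        show i + 2 - 1 = i + 1 from rfl] at dx rx dy ry
      omega
  funext i j
  by_cases hv : 1 ≤ i ∧ i + j ≤ n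
  · exact key j i hv.1 hv.2
  · rw [hx.1.1 i j hv, hy.1.1 i j hv]

/-- Extension of a tournament on `Fin n` to a function of pairs of positive labels. -/
def stepsOfTournament {n : ℕ} (f : {p : Fin n × Fin n // p.1 < p.2} → Bool) (i s : ℕ) : Bool :=
  if h : i - 1 < s - 1 ∧ s - 1 < n then f ⟨(⟨i - 1, h.1.trans h.2⟩, ⟨s - 1, h.2⟩), h.1⟩ else false

theorem tournamentOfArray_staircaseOfSteps {n : ℕ}
    (f : {p : Fin n × Fin n // p.1 < p.2} → Bool) :
    tournamentOfArray n (staircaseOfSteps n (stepsOfTournament f)) = f := by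
  funext ⟨⟨⟨i, hi⟩, ⟨s, hs⟩⟩, his⟩
  have his' : i < s := his
  obtain ⟨j, rfl⟩ := Nat.exists_eq_add_of_lt his'
  have e : i + j + 1 - i = j + 1 := by omega
  have hstep : stepsOfTournament f (i + 1) (i + 1 + j + 1) =
      f ⟨(⟨i, hi⟩, ⟨i + j + 1, hs⟩), his⟩ := by
    have e' : i + 1 + j + 1 - 1 = i + j + 1 := by omega
    simp [stepsOfTournament, e', hs, his']
  have hb := arrayOfSteps_bounds (stepsOfTournament f) (i + 2) j
  simp only [tournamentOfArray, e, Nat.add_sub_cancel]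
  rw [staircaseOfSteps_of_le _ (by omega) (by omega),
    staircaseOfSteps_of_le _ (by omega) (by omega), arrayOfSteps, hstep]
  cases f ⟨(⟨i, hi⟩, ⟨i + j + 1, hs⟩), his⟩
  · simp
  · simp only [Bool.toNat_true, decide_eq_true_eq, add_assoc, Nat.reduceAdd]
    omega

/-- Staircase arrays of order `n` satisfying `x i j ≤ x (i+1) (j-1)` and
`x i j ≤ x (i-1) (j+1) + 1` are in bijection with tournaments on `n` labeled vertices
(an assignment of a winner, encoded as a Boolean, to each pair `i < j`); in particular
there are `2^C(n,2)` such arrays. -/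
theorem staircase_blue_red_equiv_tournaments (n : ℕ) (hn : 0 < n) :
    Nonempty ({x : ℕ → ℕ → ℕ // IsStaircase n x ∧ DiagBlue n x ∧ DiagRed n x} ≃
      ({p : Fin n × Fin n // p.1 < p.2} → Bool)) ∧
    Nat.card {x : ℕ → ℕ → ℕ // IsStaircase n x ∧ DiagBlue n x ∧ DiagRed n x}
      = 2 ^ n.choose 2 := by
  have e : {x : ℕ → ℕ → ℕ // IsStaircase n x ∧ DiagBlue n x ∧ DiagRed n x} ≃
      ({p : Fin n × Fin n // p.1 < p.2} → Bool) :=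
    Equiv.ofBijective (fun x => tournamentOfArray n x.1)
      ⟨fun x y h => Subtype.ext (eq_of_tournamentOfArray_eq x.2 y.2 h),
        fun f => ⟨⟨_, staircaseOfSteps_spec n (stepsOfTournament f)⟩,
          tournamentOfArray_staircaseOfSteps f⟩⟩
  refine ⟨⟨e⟩, ?_⟩
  rw [Nat.card_congr e, Nat.card_fun, Fin.card_pairs_lt, Nat.card_eq_fintype_card,
    Fintype.card_bool]
end

section
/- For every positive integer n, the set of totally symmetric self-complementary plane partitions inside a 2n×2n×2n box is in bijection with the set of tournaments on vertices labeled 1,2,…,n satisfying the following condition on upsets: for all 1 ≤ u < v ≤ n, the number of upsets of vertex v−1 against vertices in {u, u+1, …, v−2} is at most the number of upsets of vertex v against vertices in {u, u+1, …, v−1}. In particular the two sets have the same cardinality. -/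
/-- A totally symmetric self-complementary plane partition inside a `2n × 2n × 2n` box:
an array `t : Fin (2n) → Fin (2n) → ℕ` (0-based indices) with entries at most `2n`,
weakly decreasing along rows and columns, whose solid diagram
`{(i,j,k) : 1 ≤ k ≤ t i j}` is invariant under all permutations of the three
coordinates (it suffices to require invariance under the three transpositions), and
self-complementary: `t i j + t (2n+1-i) (2n+1-j) = 2n` (in 1-based terms). -/
def IsTSSCPP (n : ℕ) (t : Fin (2 * n) → Fin (2 * n) → ℕ) : Prop :=
  (∀ i j, t i j ≤ 2 * n) ∧
  (∀ i j j' : Fin (2 * n), j ≤ j' → t i j' ≤ t i j) ∧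
  (∀ i i' j : Fin (2 * n), i ≤ i' → t i' j ≤ t i j) ∧
  (∀ i j k : Fin (2 * n), ((k : ℕ) + 1 ≤ t i j ↔ (k : ℕ) + 1 ≤ t j i)) ∧
  (∀ i j k : Fin (2 * n), ((k : ℕ) + 1 ≤ t i j ↔ (j : ℕ) + 1 ≤ t i k)) ∧
  (∀ i j k : Fin (2 * n), ((k : ℕ) + 1 ≤ t i j ↔ (i : ℕ) + 1 ≤ t k j)) ∧
  (∀ i j : Fin (2 * n), t i j + t i.rev j.rev = 2 * n)

/-- A tournament on vertices `1, …, n`, encoded as `f : ℕ → ℕ → Bool` pinned to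
`false` off the pairs `1 ≤ i < j ≤ n`; for `i < j`, `f i j = true` means `j` wins the
game between `i` and `j` (an upset). -/
def IsTournament (n : ℕ) (f : ℕ → ℕ → Bool) : Prop :=
  ∀ i j, ¬(1 ≤ i ∧ i < j ∧ j ≤ n) → f i j = false

/-- The upset condition: for all `1 ≤ u < v ≤ n`, the number of upsets of vertex `v-1`
against vertices in `{u, …, v-2}` is at most the number of upsets of vertex `v`
against vertices in `{u, …, v-1}`. -/
def UpsetCondition (n : ℕ) (f : ℕ → ℕ → Bool) : Prop :=
  ∀ u v, 1 ≤ u → u < v → v ≤ n →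
    ((Finset.Icc u (v - 2)).filter (fun w => f w (v - 1) = true)).card ≤
    ((Finset.Icc u (v - 1)).filter (fun w => f w v = true)).card

open Finset

theorem Nat.lt_card_filter_range_iff {P : ℕ → Prop} [DecidablePred P] {N : ℕ}
    (hP : ∀ k, P (k + 1) → P k) (hN : ∀ k, P k → k < N) (k : ℕ) :
    k < #{x ∈ range N | P x} ↔ P k := by
  have hex : ∃ m, ¬ P m := ⟨N, fun h => lt_irrefl _ (hN N h)⟩
  have hlt : ∀ k, P k ↔ k < Nat.find hex := by
    intro k
    refine ⟨fun hk => ?_, fun hk => not_not.1 (Nat.find_min hex hk)⟩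
    by_contra! hle
    exact Nat.find_spec hex (Nat.decreasingInduction (fun j _ => hP j) hk hle)
  have : ({x ∈ range N | P x} : Finset ℕ) = range (Nat.find hex) := by
    ext x
    simp only [mem_filter, mem_range, ← hlt]
    exact ⟨fun h => h.2, fun h => ⟨hN x h, h⟩⟩
  rw [this, card_range, hlt]

/-- The arrays arising as the quadrant `(t (n + a) (n + b))` of a TSSCPP (0-based indices),
extended by zero: symmetric, weakly decreasing, with column `b` bounded by `n - 1 - b`. -/
structure IsQuadrant (n : ℕ) (q : ℕ → ℕ → ℕ) : Prop where
  symm : ∀ a b, q a b = q b a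
  succ_le : ∀ a b, q a (b + 1) ≤ q a b
  le : ∀ a b, q a b ≤ n - 1 - b

namespace IsQuadrant

variable {n : ℕ} {q : ℕ → ℕ → ℕ}

theorem succ_le_left (hq : IsQuadrant n q) (a b : ℕ) : q (a + 1) b ≤ q a b := by
  rw [hq.symm, hq.symm a]; exact hq.succ_le b a

end IsQuadrant

/-! ### From TSSCPPs to quadrants -/

/-- The quadrant of `t` consisting of the entries with both indices at least `n`. -/
def quadrant (n : ℕ) (t : Fin (2 * n) → Fin (2 * n) → ℕ) (a b : ℕ) : ℕ :=
  if h : a < n ∧ b < n then t ⟨n + a, by omega⟩ ⟨n + b, by omega⟩ else 0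

namespace IsTSSCPP

variable {n : ℕ} {t s : Fin (2 * n) → Fin (2 * n) → ℕ}

theorem apply_comm (ht : IsTSSCPP n t) (i j : Fin (2 * n)) : t i j = t j i := by
  obtain ⟨hle, -, -, h, -⟩ := ht
  have key : ∀ i j, t i j ≤ t j i := by
    intro i j
    by_contra! hlt
    have := (h i j ⟨t j i, hlt.trans_le (hle i j)⟩).1 hlt
    simp at this
  exact le_antisymm (key i j) (key j i)

theorem lt_apply_swap (ht : IsTSSCPP n t) (i j k : Fin (2 * n)) :
    (k : ℕ) < t i j ↔ (j : ℕ) < t i k :=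
  ht.2.2.2.2.1 i j k

theorem lt_apply_rotate (ht : IsTSSCPP n t) (i j k : Fin (2 * n)) :
    (k : ℕ) < t i j ↔ (i : ℕ) < t j k := by
  rw [ht.apply_comm i j, ht.lt_apply_swap]

theorem lt_apply_iff_rev (ht : IsTSSCPP n t) (i j k : Fin (2 * n)) :
    (k : ℕ) < t i j ↔ ¬ (k.rev : ℕ) < t i.rev j.rev := by
  have := ht.2.2.2.2.2.2 i j
  rw [Fin.val_rev k]
  omega

theorem apply_le_of_quadrant (ht : IsTSSCPP n t) {a b : ℕ} (ha : a < n) (hb : b < n) :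
    t ⟨n + a, by omega⟩ ⟨n + b, by omega⟩ ≤ n - 1 - b := by
  by_contra! h
  let z : Fin (2 * n) := ⟨n, by omega⟩
  let j : Fin (2 * n) := ⟨n + b, by omega⟩
  let k : Fin (2 * n) := ⟨n - 1 - b, by omega⟩
  have h1 : (k : ℕ) < t z j := h.trans_le (ht.2.2.1 z _ j (Fin.mk_le_mk.2 (by omega)))
  have hj : j.rev = k := Fin.ext (by simp only [Fin.val_rev, j, k]; omega)
  have hk : k.rev = j := by rw [← hj, Fin.rev_rev]
  have h2 := (ht.lt_apply_iff_rev z j k).1 h1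
  rw [hj, hk, ht.lt_apply_swap] at h2
  exact h2 (h1.trans_le (ht.2.2.1 _ _ j (Fin.le_def.2 (by simp only [Fin.val_rev, z]; omega))))

theorem isQuadrant (ht : IsTSSCPP n t) : IsQuadrant n (quadrant n t) where
  symm a b := by
    unfold quadrant
    by_cases h : a < n ∧ b < n
    · rw [dif_pos h, dif_pos h.symm, ht.apply_comm]
    · rw [dif_neg h, dif_neg (fun h' => h h'.symm)]
  succ_le a b := by
    unfold quadrant
    by_cases h : a < n ∧ b + 1 < n
    · rw [dif_pos h, dif_pos ⟨h.1, by omega⟩]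
      exact ht.2.1 _ _ _ (Fin.mk_le_mk.2 (by omega))
    · rw [dif_neg h]; exact Nat.zero_le _
  le a b := by
    unfold quadrant
    split_ifs with h
    · exact ht.apply_le_of_quadrant h.1 h.2
    · exact Nat.zero_le _

theorem eq_of_quadrant_eq (ht : IsTSSCPP n t) (hs : IsTSSCPP n s)
    (h : quadrant n t = quadrant n s) : t = s := by
  have hh : ∀ i j : Fin (2 * n), n ≤ (i : ℕ) → n ≤ (j : ℕ) → t i j = s i j := by
    intro i j hi hj
    have := congrFun (congrFun h (i - n)) (j - n)
    unfold quadrant at this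
    rw [dif_pos (by omega), dif_pos (by omega)] at this
    convert this using 2 <;> (apply Fin.ext; simp only; omega)
  have key : ∀ i j k : Fin (2 * n), n ≤ (k : ℕ) → (n ≤ (i : ℕ) ∨ n ≤ (j : ℕ)) →
      ((k : ℕ) < t i j ↔ (k : ℕ) < s i j) := by
    intro i j k hk hij
    rcases hij with hi | hj
    · rw [ht.lt_apply_swap, hs.lt_apply_swap, hh i k hi hk]
    · rw [ht.lt_apply_rotate, hs.lt_apply_rotate, hh j k hj hk]
  have all : ∀ i j k : Fin (2 * n), ((k : ℕ) < t i j ↔ (k : ℕ) < s i j) := by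
    intro i j k
    by_cases hhi : n ≤ (i : ℕ) ∧ n ≤ (j : ℕ)
    · rw [hh i j hhi.1 hhi.2]
    by_cases hlo : (i : ℕ) < n ∧ (j : ℕ) < n
    · rw [ht.lt_apply_iff_rev, hs.lt_apply_iff_rev, hh i.rev j.rev] <;>
        (rw [Fin.val_rev]; omega)
    by_cases hk : n ≤ (k : ℕ)
    · exact key i j k hk (by omega)
    · rw [ht.lt_apply_iff_rev, hs.lt_apply_iff_rev, key i.rev j.rev k.rev]
      · rw [Fin.val_rev]; omega
      · rw [Fin.val_rev, Fin.val_rev]; omega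
  funext i j
  have h1 := ht.1 i j
  have h2 := hs.1 i j
  by_contra hne
  rcases Nat.lt_or_gt_of_ne hne with hlt | hlt
  · exact lt_irrefl _ ((all i j ⟨t i j, by omega⟩).2 hlt)
  · exact lt_irrefl _ ((all i j ⟨s i j, by omega⟩).1 hlt)

end IsTSSCPP

/-! ### From quadrants to TSSCPPs -/

/-- The cells of the solid diagram with at least two coordinates that are at least `n`. -/
def OuterCell (n : ℕ) (q : ℕ → ℕ → ℕ) (i j k : ℕ) : Prop :=
  (n ≤ i ∧ n ≤ j ∧ k < q (i - n) (j - n)) ∨ (n ≤ j ∧ n ≤ k ∧ i < q (j - n) (k - n)) ∨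
    (n ≤ k ∧ n ≤ i ∧ j < q (k - n) (i - n))

/-- At least two of the coordinates are at least `n`. -/
def TwoHigh (n i j k : ℕ) : Prop :=
  (n ≤ i ∧ n ≤ j) ∨ (n ≤ j ∧ n ≤ k) ∨ (n ≤ k ∧ n ≤ i)

/-- The solid diagram with quadrant `q`. -/
def Cell (n : ℕ) (q : ℕ → ℕ → ℕ) (i j k : ℕ) : Prop :=
  (TwoHigh n i j k ∧ OuterCell n q i j k) ∨
    (¬ TwoHigh n i j k ∧ ¬ OuterCell n q (2 * n - 1 - i) (2 * n - 1 - j) (2 * n - 1 - k))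

theorem twoHigh_swap {n i j k : ℕ} : TwoHigh n i j k ↔ TwoHigh n j i k := by
  unfold TwoHigh; tauto

theorem twoHigh_rotate {n i j k : ℕ} : TwoHigh n i j k ↔ TwoHigh n j k i := by
  unfold TwoHigh; tauto

theorem twoHigh_compl {n i j k : ℕ} (hi : i < 2 * n) (hj : j < 2 * n) (hk : k < 2 * n) :
    TwoHigh n (2 * n - 1 - i) (2 * n - 1 - j) (2 * n - 1 - k) ↔ ¬ TwoHigh n i j k := by
  unfold TwoHigh; omega

theorem outerCell_rotate {n : ℕ} {q : ℕ → ℕ → ℕ} {i j k : ℕ} :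
    OuterCell n q i j k ↔ OuterCell n q j k i := by
  unfold OuterCell; tauto

theorem cell_rotate {n : ℕ} {q : ℕ → ℕ → ℕ} {i j k : ℕ} :
    Cell n q i j k ↔ Cell n q j k i := by
  unfold Cell
  rw [twoHigh_rotate, outerCell_rotate,
    outerCell_rotate (i := 2 * n - 1 - i)]

theorem cell_compl {n : ℕ} {q : ℕ → ℕ → ℕ} {i j k : ℕ}
    (hi : i < 2 * n) (hj : j < 2 * n) (hk : k < 2 * n) :
    Cell n q (2 * n - 1 - i) (2 * n - 1 - j) (2 * n - 1 - k) ↔ ¬ Cell n q i j k := by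
  have h : ∀ {x}, x < 2 * n → 2 * n - 1 - (2 * n - 1 - x) = x := by intros; omega
  unfold Cell
  rw [twoHigh_compl hi hj hk, h hi, h hj, h hk]
  tauto

namespace IsQuadrant

variable {n : ℕ} {q : ℕ → ℕ → ℕ}

theorem outerCell_swap (hq : IsQuadrant n q) {i j k : ℕ} :
    OuterCell n q i j k ↔ OuterCell n q j i k := by
  unfold OuterCell
  rw [hq.symm (i - n), hq.symm (j - n) (k - n), hq.symm (k - n) (i - n)]
  tauto

theorem cell_swap (hq : IsQuadrant n q) {i j k : ℕ} : Cell n q i j k ↔ Cell n q j i k := by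
  unfold Cell
  rw [twoHigh_swap, hq.outerCell_swap, hq.outerCell_swap (i := 2 * n - 1 - i)]

theorem outerCell_of_succ (hq : IsQuadrant n q) {i j k : ℕ} (h2 : TwoHigh n i j k)
    (h : OuterCell n q i j (k + 1)) : OuterCell n q i j k := by
  have hle := hq.le
  rcases h with ⟨hi, hj, h⟩ | ⟨hj, hk, h⟩ | ⟨hk, hi, h⟩
  · exact Or.inl ⟨hi, hj, by omega⟩
  · by_cases hkn : n ≤ k
    · refine Or.inr (Or.inl ⟨hj, hkn, h.trans_le ?_⟩)
      rw [Nat.sub_add_comm hkn]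
      exact hq.succ_le _ _
    · have := hle (j - n) (k + 1 - n)
      unfold TwoHigh at h2
      omega
  · by_cases hkn : n ≤ k
    · refine Or.inr (Or.inr ⟨hkn, hi, h.trans_le ?_⟩)
      rw [Nat.sub_add_comm hkn]
      exact hq.succ_le_left _ _
    · have := hle (k + 1 - n) (i - n)
      unfold TwoHigh at h2
      omega

theorem cell_of_succ (hq : IsQuadrant n q) {i j k : ℕ} (hi : i < 2 * n) (hj : j < 2 * n)
    (hk : k + 1 < 2 * n) (h : Cell n q i j (k + 1)) : Cell n q i j k := by
  have hk' : 2 * n - 1 - k = 2 * n - 1 - (k + 1) + 1 := by omega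
  rcases h with ⟨h2, h⟩ | ⟨h2, h⟩
  · by_cases h3 : TwoHigh n i j k
    · exact Or.inl ⟨h3, hq.outerCell_of_succ h3 h⟩
    · refine Or.inr ⟨h3, fun h' => ?_⟩
      have hkn : k + 1 = n := by unfold TwoHigh at h2 h3; omega
      have e : 2 * n - 1 - k = n := by omega
      rw [e] at h'
      rw [hkn] at h
      have b2 := hq.le (n - n) (i - n)
      have b4 := hq.le (n - n) (2 * n - 1 - i - n)
      have c1 := hq.le (n - n) (j - n)
      have c3 := hq.le (n - n) (2 * n - 1 - j - n)
      rw [hq.symm] at c1 c3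
      unfold TwoHigh at h2 h3
      unfold OuterCell at h h'
      omega
  · have h3 : ¬ TwoHigh n i j k := by unfold TwoHigh at h2 ⊢; omega
    refine Or.inr ⟨h3, fun h' => h ?_⟩
    rw [hk'] at h'
    exact hq.outerCell_of_succ ((twoHigh_compl hi hj hk).2 h2) h'

open Classical in
theorem exists_isTSSCPP (hq : IsQuadrant n q) :
    ∃ t : Fin (2 * n) → Fin (2 * n) → ℕ, IsTSSCPP n t ∧ quadrant n t = q := by
  let t : Fin (2 * n) → Fin (2 * n) → ℕ := fun i j =>
    #{k ∈ range (2 * n) | k < 2 * n ∧ Cell n q i j k}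
  have lt_t : ∀ (i j : Fin (2 * n)) (k : ℕ), k < t i j ↔ k < 2 * n ∧ Cell n q i j k :=
    fun i j k => Nat.lt_card_filter_range_iff
      (fun k hk => ⟨by omega, hq.cell_of_succ i.2 j.2 hk.1 hk.2⟩) (fun k hk => hk.1) k
  have lt_t' : ∀ i j k : Fin (2 * n), (k : ℕ) < t i j ↔ Cell n q i j k :=
    fun i j k => (lt_t i j k).trans (and_iff_right k.2)
  have t_le : ∀ i j, t i j ≤ 2 * n := fun i j => by
    by_contra! h
    exact lt_irrefl _ ((lt_t i j _).1 h).1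
  have anti : ∀ i j j' : Fin (2 * n), j ≤ j' → t i j' ≤ t i j := by
    intro i j j' hj
    by_contra! h
    obtain ⟨hk, h1⟩ := (lt_t i j' _).1 h
    have h2 : ¬ Cell n q i j (t i j) := fun h' => lt_irrefl _ ((lt_t i j _).2 ⟨hk, h'⟩)
    rw [cell_rotate, cell_rotate] at h1 h2
    refine h2 (Nat.decreasingInduction' (P := fun x => Cell n q _ _ x) (fun x hx _ hc => ?_)
      (Fin.le_def.1 hj) h1)
    exact hq.cell_of_succ (by omega) (by omega) (by omega) hc
  have comm : ∀ i j, t i j = t j i := by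
    intro i j
    simp only [t]
    congr 1
    ext k
    simp only [mem_filter, hq.cell_swap (i := (i : ℕ))]
  refine ⟨t, ⟨t_le, anti, ?_, ?_, ?_, ?_, ?_⟩, ?_⟩
  · intro i i' j h
    rw [comm i', comm i]
    exact anti j i i' h
  · intro i j k
    rw [comm]
  · intro i j k
    rw [Nat.succ_le_iff, Nat.succ_le_iff, lt_t', lt_t', cell_rotate, hq.cell_swap,
      cell_rotate, cell_rotate]
  · intro i j k
    rw [Nat.succ_le_iff, Nat.succ_le_iff, lt_t', lt_t', hq.cell_swap, cell_rotate, cell_rotate,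
      cell_rotate]
  · intro i j
    have key : ∀ k < 2 * n, k < t i j ↔ ¬ 2 * n - 1 - k < t i.rev j.rev := by
      intro k hk
      rw [lt_t, lt_t, and_iff_right hk, and_iff_right (by omega)]
      have e : ∀ x : Fin (2 * n), (x.rev : ℕ) = 2 * n - 1 - x := fun x => by
        rw [Fin.val_rev]; omega
      rw [e, e, cell_compl i.2 j.2 hk, not_not]
    have h1 := t_le i j
    have h2 := t_le i.rev j.rev
    by_contra hne
    rcases Nat.lt_or_gt_of_ne hne with hlt | hlt
    · have := key (t i j) (by omega)
      omega
    · have := key (t i j - 1) (by omega)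
      omega
  · funext a b
    have hab := hq.le a b
    have hba := hq.le b a
    rw [hq.symm] at hba
    unfold quadrant
    split_ifs with h
    · have key : ∀ k, k < t ⟨n + a, by omega⟩ ⟨n + b, by omega⟩ ↔ k < q a b := by
        intro k
        rw [lt_t]
        have h2 : TwoHigh n (n + a) (n + b) k := Or.inl ⟨by omega, by omega⟩
        have b1 := hq.le (k - n) a
        have b2 := hq.le b (k - n)
        simp only [Cell, h2, OuterCell, Nat.add_sub_cancel_left, true_and, not_true, false_and,
          or_false]
        omega
      exact le_antisymm (le_of_forall_lt fun k hk => (key k).1 hk)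
        (le_of_forall_lt fun k hk => (key k).2 hk)
    · omega

end IsQuadrant

/-! ### Quadrants and tournaments -/

/-- The number of upsets of vertex `v` against the vertices in `{u, …, v - 1}`. -/
def upsets (f : ℕ → ℕ → Bool) (v u : ℕ) : ℕ :=
  #{w ∈ Icc u (v - 1) | f w v = true}

theorem upsets_eq_zero (f : ℕ → ℕ → Bool) {v u : ℕ} (hu : 1 ≤ u) (h : v ≤ u) :
    upsets f v u = 0 := by
  rw [upsets, Icc_eq_empty (by omega)]; rfl

theorem upsets_eq_add (f : ℕ → ℕ → Bool) {v u : ℕ} (h : u < v) :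
    upsets f v u = upsets f v (u + 1) + (f u v).toNat := by
  unfold upsets
  rw [← insert_Icc_add_one_left_eq_Icc (show u ≤ v - 1 by omega), filter_insert]
  cases hf : f u v <;> simp

theorem upsets_le (f : ℕ → ℕ → Bool) (v u : ℕ) (hv : 0 < v) : upsets f v u ≤ v - u :=
  (card_filter_le _ _).trans (by rw [Nat.card_Icc]; omega)

/-- The number of diagonal entries `q a (a + u - 1)` that are at least `n + 1 - v`. -/
def levelCount (n : ℕ) (q : ℕ → ℕ → ℕ) (v u : ℕ) : ℕ :=
  #{a ∈ range n | n - v < q a (a + u - 1)}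

/-- The tournament whose column `v` lists the shifted row lengths of the level set
`{(a, b) | n + 1 - v ≤ q a b}`. -/
def tournamentOf (n : ℕ) (q : ℕ → ℕ → ℕ) (w v : ℕ) : Bool :=
  decide ((1 ≤ w ∧ w < v ∧ v ≤ n) ∧ levelCount n q v (w + 1) < levelCount n q v w)

theorem isTournament_tournamentOf (n : ℕ) (q : ℕ → ℕ → ℕ) :
    IsTournament n (tournamentOf n q) := fun i j h => by
  simp [tournamentOf, h]

namespace IsQuadrant

variable {n : ℕ} {q : ℕ → ℕ → ℕ}

theorem lt_levelCount (hq : IsQuadrant n q) {v u : ℕ} (hu : 1 ≤ u) (a : ℕ) :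
    a < levelCount n q v u ↔ n - v < q a (a + u - 1) := by
  refine Nat.lt_card_filter_range_iff (P := fun a => n - v < q a (a + u - 1))
    (fun a ha => ha.trans_le ?_) (fun a ha => ?_) a
  · obtain ⟨u, rfl⟩ := Nat.exists_eq_add_of_le' hu
    exact (hq.succ_le_left _ _).trans (by
      have := hq.succ_le a (a + u)
      rwa [show a + 1 + (u + 1) - 1 = a + u + 1 by omega])
  · have := hq.le a (a + u - 1)
    omega

theorem levelCount_eq_zero (hq : IsQuadrant n q) {v u : ℕ} (hu : 1 ≤ u) (h : v ≤ u) :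
    levelCount n q v u = 0 := by
  by_contra hne
  have h1 := (hq.lt_levelCount hu 0).1 (Nat.pos_of_ne_zero hne)
  have := hq.le 0 (0 + u - 1)
  omega

theorem levelCount_succ_le (hq : IsQuadrant n q) {v u : ℕ} (hu : 1 ≤ u) :
    levelCount n q v (u + 1) ≤ levelCount n q v u := by
  refine le_of_forall_lt fun a ha => ?_
  rw [hq.lt_levelCount (by omega)] at ha
  rw [hq.lt_levelCount hu]
  have := hq.succ_le a (a + u - 1)
  rw [show a + u - 1 + 1 = a + (u + 1) - 1 by omega] at this
  omega

theorem levelCount_le_succ (hq : IsQuadrant n q) {v u : ℕ} (hu : 1 ≤ u) :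
    levelCount n q v u ≤ levelCount n q v (u + 1) + 1 := by
  by_contra! h
  rw [hq.lt_levelCount hu] at h
  set c := levelCount n q v (u + 1)
  have h1 : ¬ c < levelCount n q v (u + 1) := by omega
  rw [hq.lt_levelCount (by omega)] at h1
  have := hq.succ_le_left c (c + u)
  rw [show c + 1 + u - 1 = c + u by omega] at h
  rw [show c + (u + 1) - 1 = c + u by omega] at h1
  omega

theorem upsets_tournamentOf (hq : IsQuadrant n q) {v : ℕ} (hv : v ≤ n) {u : ℕ} (hu : 1 ≤ u) :
    upsets (tournamentOf n q) v u = levelCount n q v u := by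
  rcases le_or_gt v u with h | h
  · rw [upsets_eq_zero _ hu h, hq.levelCount_eq_zero hu h]
  · rw [upsets_eq_add _ h, hq.upsets_tournamentOf hv (Nat.le_add_left 1 u)]
    have h1 := hq.levelCount_succ_le (v := v) hu
    have h2 := hq.levelCount_le_succ (v := v) hu
    by_cases hlt : levelCount n q v (u + 1) < levelCount n q v u
    · rw [tournamentOf, decide_eq_true ⟨⟨hu, h, hv⟩, hlt⟩, Bool.toNat_true]
      omega
    · rw [tournamentOf, decide_eq_false (fun h' => hlt h'.2), Bool.toNat_false]
      omega
termination_by v - u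

theorem upsetCondition_tournamentOf (hq : IsQuadrant n q) :
    UpsetCondition n (tournamentOf n q) := by
  intro u v hu huv hv
  change upsets _ (v - 1) u ≤ upsets _ v u
  rw [hq.upsets_tournamentOf (by omega) hu, hq.upsets_tournamentOf hv hu]
  refine le_of_forall_lt fun a ha => ?_
  rw [hq.lt_levelCount hu] at ha ⊢
  omega

theorem eq_of_tournamentOf_eq {r : ℕ → ℕ → ℕ} (hq : IsQuadrant n q) (hr : IsQuadrant n r)
    (h : tournamentOf n q = tournamentOf n r) : q = r := by
  have key : ∀ a d k, k < n → (k < q a (a + d) ↔ k < r a (a + d)) := by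
    intro a d k hk
    have h1 := hq.lt_levelCount (v := n - k) (u := d + 1) (by omega) a
    have h2 := hr.lt_levelCount (v := n - k) (u := d + 1) (by omega) a
    rw [← hq.upsets_tournamentOf (by omega) (by omega)] at h1
    rw [← hr.upsets_tournamentOf (by omega) (by omega), ← h, h1] at h2
    rwa [Nat.sub_sub_self hk.le, ← add_assoc, Nat.add_sub_cancel] at h2
  have diag : ∀ a d, q a (a + d) = r a (a + d) := by
    intro a d
    have h1 := hq.le a (a + d)
    have h2 := hr.le a (a + d)
    have h3 := key a d (q a (a + d))
    have h4 := key a d (r a (a + d))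
    omega
  funext a b
  rcases le_total a b with hab | hab
  · obtain ⟨d, rfl⟩ := Nat.exists_eq_add_of_le hab
    exact diag a d
  · obtain ⟨d, rfl⟩ := Nat.exists_eq_add_of_le hab
    rw [hq.symm, hr.symm]
    exact diag b d

end IsQuadrant

/-- The quadrant of a tournament: the number of vertices `v = n - k` with more than `min a b`
upsets against the vertices from `|a - b| + 1` on. -/
def quadrantOf (n : ℕ) (f : ℕ → ℕ → Bool) (a b : ℕ) : ℕ :=
  #{k ∈ range n | min a b < upsets f (n - k) (max a b - min a b + 1)}

namespace UpsetCondition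

variable {n : ℕ} {f : ℕ → ℕ → Bool}

theorem lt_quadrantOf (hf : UpsetCondition n f) (a b k : ℕ) :
    k < quadrantOf n f a b ↔ min a b < upsets f (n - k) (max a b - min a b + 1) := by
  refine Nat.lt_card_filter_range_iff
    (P := fun k => min a b < upsets f (n - k) (max a b - min a b + 1))
    (fun k hk => hk.trans_le ?_) (fun k hk => ?_) k
  · rcases Nat.lt_or_ge (max a b - min a b + 1) (n - k) with h | h
    · exact hf _ (n - k) (by omega) h (by omega)
    · rw [upsets_eq_zero _ (by omega) (by omega)]
      exact Nat.zero_le _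
  · by_contra! h
    rw [upsets_eq_zero _ (by omega) (by omega)] at hk
    omega

theorem isQuadrant_quadrantOf (hf : UpsetCondition n f) : IsQuadrant n (quadrantOf n f) where
  symm a b := by unfold quadrantOf; rw [min_comm, max_comm]
  succ_le a b := by
    refine le_of_forall_lt fun k hk => ?_
    rw [hf.lt_quadrantOf] at hk ⊢
    rcases le_or_gt a b with h | h
    · rw [min_eq_left (by omega), max_eq_right (by omega)] at hk ⊢
      refine hk.trans_le ?_
      rw [show b + 1 - a + 1 = b - a + 1 + 1 by omega]
      rcases Nat.lt_or_ge (b - a + 1) (n - k) with h' | h'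
      · rw [upsets_eq_add f h']; exact Nat.le_add_right _ _
      · rw [upsets_eq_zero _ (by omega) (by omega)]
        exact Nat.zero_le _
    · rw [min_eq_right (by omega), max_eq_left (by omega)] at hk ⊢
      rw [show a - (b + 1) + 1 = a - b by omega] at hk
      rcases Nat.lt_or_ge (a - b) (n - k) with h' | h'
      · rw [upsets_eq_add f h'] at hk
        have := Bool.toNat_le (f (a - b) (n - k))
        omega
      · rw [upsets_eq_zero _ (by omega) (by omega)] at hk
        omega
  le a b := by
    refine le_of_forall_lt fun k hk => ?_
    rw [hf.lt_quadrantOf] at hk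
    rcases Nat.eq_zero_or_pos (n - k) with h | h
    · rw [upsets_eq_zero _ (by omega) (by omega)] at hk
      omega
    · have := upsets_le f (n - k) (max a b - min a b + 1) h
      omega

theorem levelCount_quadrantOf (hf : UpsetCondition n f) {v u : ℕ} (hv : v ≤ n) (hu : 1 ≤ u) :
    levelCount n (quadrantOf n f) v u = upsets f v u := by
  refine eq_of_forall_lt_iff fun a => ?_
  rw [hf.isQuadrant_quadrantOf.lt_levelCount hu, hf.lt_quadrantOf, min_eq_left (by omega),
    max_eq_right (by omega), Nat.sub_sub_self hv, show a + u - 1 - a + 1 = u by omega]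

theorem tournamentOf_quadrantOf (hf : UpsetCondition n f) (ht : IsTournament n f) :
    tournamentOf n (quadrantOf n f) = f := by
  funext w v
  by_cases h : 1 ≤ w ∧ w < v ∧ v ≤ n
  · rw [tournamentOf, hf.levelCount_quadrantOf h.2.2 h.1,
      hf.levelCount_quadrantOf h.2.2 (by omega), upsets_eq_add f h.2.1]
    cases f w v <;> simp [h]
  · rw [ht w v h, tournamentOf, decide_eq_false (fun h' => h h'.1)]

end UpsetCondition

/-- TSSCPPs are determined by their quadrants. -/
noncomputable def tsscppEquivQuadrant (n : ℕ) :
    {t : Fin (2 * n) → Fin (2 * n) → ℕ // IsTSSCPP n t} ≃ {q : ℕ → ℕ → ℕ // IsQuadrant n q} :=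
  Equiv.ofBijective (fun t => ⟨quadrant n t.1, t.2.isQuadrant⟩)
    ⟨fun t s h => Subtype.ext (t.2.eq_of_quadrant_eq s.2 (congrArg Subtype.val h)),
      fun q => let ⟨t, ht, h⟩ := q.2.exists_isTSSCPP; ⟨⟨t, ht⟩, Subtype.ext h⟩⟩

/-- Quadrants correspond to tournaments satisfying the upset condition. -/
def quadrantEquivTournament (n : ℕ) :
    {q : ℕ → ℕ → ℕ // IsQuadrant n q} ≃
      {f : ℕ → ℕ → Bool // IsTournament n f ∧ UpsetCondition n f} where
  toFun q := ⟨tournamentOf n q.1, isTournament_tournamentOf n q.1,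
    q.2.upsetCondition_tournamentOf⟩
  invFun f := ⟨quadrantOf n f.1, f.2.2.isQuadrant_quadrantOf⟩
  left_inv q := Subtype.ext <|
    q.2.upsetCondition_tournamentOf.isQuadrant_quadrantOf.eq_of_tournamentOf_eq q.2
      (q.2.upsetCondition_tournamentOf.tournamentOf_quadrantOf (isTournament_tournamentOf n q.1))
  right_inv f := Subtype.ext (f.2.2.tournamentOf_quadrantOf f.2.1)

/-- TSSCPPs inside a `2n × 2n × 2n` box are in bijection with tournaments on
`n` vertices satisfying the upset condition; in particular the two sets have the same
cardinality. -/
theorem tsscpp_equiv_tournaments (n : ℕ) (hn : 0 < n) :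
    Nonempty ({t : Fin (2 * n) → Fin (2 * n) → ℕ // IsTSSCPP n t} ≃
      {f : ℕ → ℕ → Bool // IsTournament n f ∧ UpsetCondition n f}) ∧
    Nat.card {t : Fin (2 * n) → Fin (2 * n) → ℕ // IsTSSCPP n t} =
      Nat.card {f : ℕ → ℕ → Bool // IsTournament n f ∧ UpsetCondition n f} := by
  have e := (tsscppEquivQuadrant n).trans (quadrantEquivTournament n)
  exact ⟨⟨e⟩, Nat.card_congr e⟩
end
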